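/- arXiv:2108.06744 — 11 statements merged into one kernel-verified Lean document; each statement's English description precedes it below -/
import Mathlib

section
/- Let (A,·,T) be a Rota-Baxter algebra of weight λ over a field k of characteristic 0 and (M,T_M) a Rota-Baxter bimodule over it. Define a ▷ m := T(a)m − T_M(am) and m ◁ a := mT(a) − T_M(ma) for a ∈ A, m ∈ M. Then for all a, b ∈ A and m ∈ M: (a ⋆ b) ▷ m = a ▷ (b ▷ m); m ◁ (a ⋆ b) = (m ◁ a) ◁ b; (a ▷ m) ◁ b = a ▷ (m ◁ b); T(a) ▷ T_M(m) = T_M(a ▷ T_M(m) + T(a) ▷ m + λ a ▷ m); and T_M(m) ◁ T(a) = T_M(m ◁ T(a) + T_M(m) ◁ a + λ m ◁ a). In other words, (M, ▷, ◁, T_M) is a Rota-Baxter bimodule over the Rota-Baxter algebra (A,⋆,T). -/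
/-- Let `(A, ·, T)` be a Rota-Baxter algebra of weight `lam` and `(M, TM)` a Rota-Baxter
bimodule over it (left action `l`, right action `r a m = m ◁ a`).  Define
`a ▷ m := T(a)m − TM(am)` and `m ◁' a := m T(a) − TM(ma)`.  Then `(M, ▷, ◁', TM)` is a
Rota-Baxter bimodule over the Rota-Baxter algebra `(A, ⋆, T)`. -/
theorem newBimodule {k A M : Type*} [Field k] [CharZero k]
    [NonUnitalRing A] [Module k A] [SMulCommClass k A A] [IsScalarTower k A A]
    [AddCommGroup M] [Module k M]
    (lam : k) (T : A →ₗ[k] A)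
    (hT : ∀ a b : A, T a * T b = T (a * T b + T a * b + lam • (a * b)))
    (l r : A →ₗ[k] M →ₗ[k] M)
    (hl : ∀ (a b : A) (m : M), l (a * b) m = l a (l b m))
    (hr : ∀ (a b : A) (m : M), r (a * b) m = r b (r a m))
    (hlr : ∀ (a b : A) (m : M), r b (l a m) = l a (r b m))
    (TM : M →ₗ[k] M)
    (hTM1 : ∀ (a : A) (m : M), l (T a) (TM m) = TM (l a (TM m) + l (T a) m + lam • l a m))
    (hTM2 : ∀ (a : A) (m : M), r (T a) (TM m) = TM (r (T a) m + r a (TM m) + lam • r a m))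
    (star : A → A → A)
    (hstar : ∀ a b : A, star a b = a * T b + T a * b + lam • (a * b))
    (nl nr : A → M → M)
    (hnl : ∀ (a : A) (m : M), nl a m = l (T a) m - TM (l a m))
    (hnr : ∀ (a : A) (m : M), nr a m = r (T a) m - TM (r a m)) :
    (∀ (a b : A) (m : M), nl (star a b) m = nl a (nl b m)) ∧
    (∀ (a b : A) (m : M), nr (star a b) m = nr b (nr a m)) ∧
    (∀ (a b : A) (m : M), nr b (nl a m) = nl a (nr b m)) ∧
    (∀ (a : A) (m : M), nl (T a) (TM m) = TM (nl a (TM m) + nl (T a) m + lam • nl a m)) ∧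
    (∀ (a : A) (m : M), nr (T a) (TM m) = TM (nr (T a) m + nr a (TM m) + lam • nr a m)) := by
  refine ⟨fun a b m => ?_, fun a b m => ?_, fun a b m => ?_, fun a m => ?_, fun a m => ?_⟩
  · rw [hnl, hstar, ← hT, hnl, hnl]
    simp only [map_add, map_sub, map_smul, LinearMap.add_apply, LinearMap.smul_apply, hl, hTM1]
    abel
  · rw [hnr, hstar, ← hT, hnr, hnr]
    simp only [map_add, map_sub, map_smul, LinearMap.add_apply, LinearMap.smul_apply, hr, hTM2]
    abel
  · simp only [hnl, hnr, map_add, map_sub, map_smul, hlr, hTM1, hTM2]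
    abel
  · simp only [hnl, map_add, map_sub, map_smul, smul_sub, hTM1]
    abel
  · simp only [hnr, map_add, map_sub, map_smul, smul_sub, hTM2]
    abel
end

section
/- Let (A,·,T) be a Rota-Baxter algebra of weight λ over a field k of characteristic 0 and let (μ_i, T_i)_{i≥0} be a 1-parameter formal deformation of (A,·,T). Then the infinitesimal (μ₁, T₁) is a 2-cocycle of the Rota-Baxter algebra A with coefficients in the regular Rota-Baxter bimodule (A,T): for all a, b, c ∈ A, a·μ₁(b,c) − μ₁(a·b, c) + μ₁(a, b·c) − μ₁(a,b)·c = 0, and T(a)·T₁(b) − T(a·T₁(b)) − T₁(a·T(b)) − T₁(T(a)·b) − λT₁(a·b) + T₁(a)·T(b) − T(T₁(a)·b) + μ₁(T(a),T(b)) − T(μ₁(a,T(b))) − T(μ₁(T(a),b)) − λT(μ₁(a,b)) = 0. -/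
open Finset in
/-- The infinitesimal `(μ₁, T₁)` of a 1-parameter formal deformation of a Rota-Baxter
algebra `(A, ·, T)` of weight `lam` is a 2-cocycle in the cochain complex of the
Rota-Baxter algebra with coefficients in the regular Rota-Baxter bimodule. -/
theorem infinitesimal_isTwoCocycle {k A : Type*} [Field k] [CharZero k]
    [NonUnitalRing A] [Module k A] [SMulCommClass k A A] [IsScalarTower k A A]
    (lam : k) (T : A →ₗ[k] A)
    (hT : ∀ a b : A, T a * T b = T (a * T b + T a * b + lam • (a * b)))
    (μ : ℕ → A →ₗ[k] A →ₗ[k] A) (Td : ℕ → A →ₗ[k] A)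
    (hμ0 : ∀ a b : A, μ 0 a b = a * b) (hT0 : Td 0 = T)
    (hassoc : ∀ (n : ℕ) (a b c : A),
      ∑ p ∈ antidiagonal n, μ p.1 (μ p.2 a b) c
        = ∑ p ∈ antidiagonal n, μ p.1 a (μ p.2 b c))
    (hrb : ∀ (n : ℕ) (a b : A),
      ∑ p ∈ antidiagonal n, ∑ q ∈ antidiagonal p.2, μ p.1 (Td q.1 a) (Td q.2 b)
        = ∑ p ∈ antidiagonal n, ∑ q ∈ antidiagonal p.2, Td p.1 (μ q.1 a (Td q.2 b))
          + ∑ p ∈ antidiagonal n, ∑ q ∈ antidiagonal p.2, Td p.1 (μ q.1 (Td q.2 a) b)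
          + lam • ∑ p ∈ antidiagonal n, Td p.1 (μ p.2 a b)) :
    (∀ a b c : A, a * μ 1 b c - μ 1 (a * b) c + μ 1 a (b * c) - μ 1 a b * c = 0) ∧
    (∀ a b : A,
      T a * Td 1 b - T (a * Td 1 b) - Td 1 (a * T b) - Td 1 (T a * b) - lam • Td 1 (a * b)
        + Td 1 a * T b - T (Td 1 a * b)
        + μ 1 (T a) (T b) - T (μ 1 a (T b)) - T (μ 1 (T a) b) - lam • T (μ 1 a b) = 0) := by
  subst hT0
  have antidiagonal_one : antidiagonal 1 = {((0 : ℕ), (1 : ℕ)), (1, 0)} := rfl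
  refine ⟨fun a b c => ?_, fun a b => ?_⟩
  · have h := hassoc 1 a b c
    simp only [antidiagonal_one, sum_pair (show ((0 : ℕ), 1) ≠ (1, 0) by decide), hμ0] at h
    rw [← sub_eq_zero] at h
    rw [← neg_eq_zero, ← h]
    abel
  · have h := hrb 1 a b
    simp only [antidiagonal_one, Nat.antidiagonal_zero, sum_singleton,
      sum_pair (show ((0 : ℕ), 1) ≠ (1, 0) by decide), hμ0, smul_add] at h
    rw [← sub_eq_zero] at h
    rw [← h]
    abel
end

section
/- Let (A,·,T) be a Rota-Baxter algebra of weight λ over a field k of characteristic 0 and let (μ_i, T_i)_{i≥0} and (μ_i', T_i')_{i≥0} be two 1-parameter formal deformations of (A,·,T). Suppose they are equivalent via a formal isomorphism, i.e. there are k-linear maps ψ_i : A → A (i ≥ 0) with ψ₀ = id_A such that for all n ≥ 0 and a, b ∈ A: Σ_{i+j=n} ψ_i(μ_j'(a,b)) = Σ_{i+j+k=n} μ_i(ψ_j(a), ψ_k(b)) and Σ_{i+j=n} ψ_i(T_j'(a)) = Σ_{i+j=n} T_i(ψ_j(a)). Then for all a, b ∈ A: μ₁'(a,b) = μ₁(a,b)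 + a·ψ₁(b) − ψ₁(a·b) + ψ₁(a)·b and T₁'(a) = T₁(a) + T(ψ₁(a)) − ψ₁(T(a)); i.e. the infinitesimals (μ₁',T₁') and (μ₁,T₁) differ by the coboundary d¹(ψ₁, 0), so equivalent deformations have cohomologous infinitesimals. -/
open Finset in
/-- The infinitesimals of two equivalent 1-parameter formal deformations of a Rota-Baxter
algebra `(A, ·, T)` differ by the coboundary `d¹(ψ₁, 0)`, hence are cohomologous. -/
theorem equivalentDeformations_infinitesimals {k A : Type*} [Field k] [CharZero k]
    [NonUnitalRing A] [Module k A] [SMulCommClass k A A] [IsScalarTower k A A]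
    (lam : k) (T : A →ₗ[k] A)
    (hT : ∀ a b : A, T a * T b = T (a * T b + T a * b + lam • (a * b)))
    (μ : ℕ → A →ₗ[k] A →ₗ[k] A) (Td : ℕ → A →ₗ[k] A)
    (hμ0 : ∀ a b : A, μ 0 a b = a * b) (hT0 : Td 0 = T)
    (hassoc : ∀ (n : ℕ) (a b c : A),
      ∑ p ∈ antidiagonal n, μ p.1 (μ p.2 a b) c
        = ∑ p ∈ antidiagonal n, μ p.1 a (μ p.2 b c))
    (hrb : ∀ (n : ℕ) (a b : A),
      ∑ p ∈ antidiagonal n, ∑ q ∈ antidiagonal p.2, μ p.1 (Td q.1 a) (Td q.2 b)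
        = ∑ p ∈ antidiagonal n, ∑ q ∈ antidiagonal p.2, Td p.1 (μ q.1 a (Td q.2 b))
          + ∑ p ∈ antidiagonal n, ∑ q ∈ antidiagonal p.2, Td p.1 (μ q.1 (Td q.2 a) b)
          + lam • ∑ p ∈ antidiagonal n, Td p.1 (μ p.2 a b))
    (μ' : ℕ → A →ₗ[k] A →ₗ[k] A) (Td' : ℕ → A →ₗ[k] A)
    (hμ0' : ∀ a b : A, μ' 0 a b = a * b) (hT0' : Td' 0 = T)
    (hassoc' : ∀ (n : ℕ) (a b c : A),
      ∑ p ∈ antidiagonal n, μ' p.1 (μ' p.2 a b) c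
        = ∑ p ∈ antidiagonal n, μ' p.1 a (μ' p.2 b c))
    (hrb' : ∀ (n : ℕ) (a b : A),
      ∑ p ∈ antidiagonal n, ∑ q ∈ antidiagonal p.2, μ' p.1 (Td' q.1 a) (Td' q.2 b)
        = ∑ p ∈ antidiagonal n, ∑ q ∈ antidiagonal p.2, Td' p.1 (μ' q.1 a (Td' q.2 b))
          + ∑ p ∈ antidiagonal n, ∑ q ∈ antidiagonal p.2, Td' p.1 (μ' q.1 (Td' q.2 a) b)
          + lam • ∑ p ∈ antidiagonal n, Td' p.1 (μ' p.2 a b))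
    (ψ : ℕ → A →ₗ[k] A) (hψ0 : ψ 0 = LinearMap.id)
    (hequiv1 : ∀ (n : ℕ) (a b : A),
      ∑ p ∈ antidiagonal n, ψ p.1 (μ' p.2 a b)
        = ∑ p ∈ antidiagonal n, ∑ q ∈ antidiagonal p.2, μ p.1 (ψ q.1 a) (ψ q.2 b))
    (hequiv2 : ∀ (n : ℕ) (a : A),
      ∑ p ∈ antidiagonal n, ψ p.1 (Td' p.2 a) = ∑ p ∈ antidiagonal n, Td p.1 (ψ p.2 a)) :
    (∀ a b : A, μ' 1 a b = μ 1 a b + a * ψ 1 b - ψ 1 (a * b) + ψ 1 a * b) ∧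
    (∀ a : A, Td' 1 a = Td 1 a + T (ψ 1 a) - ψ 1 (T a)) := by
  refine ⟨fun a b => ?_, fun a => ?_⟩
  · have h := hequiv1 1 a b
    simp only [Nat.sum_antidiagonal_succ, Nat.antidiagonal_zero, sum_singleton, zero_add, hψ0,
      hμ0, hμ0', LinearMap.id_apply] at h
    rw [eq_sub_of_add_eq h]
    abel
  · have h := hequiv2 1 a
    simp only [Nat.sum_antidiagonal_succ, Nat.antidiagonal_zero, sum_singleton, zero_add, hψ0,
      hT0, hT0', LinearMap.id_apply] at h
    exact eq_sub_of_add_eq (h.trans (add_comm _ _))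
end

section
/- Let (A,·,T) be a Rota-Baxter algebra of weight λ over a field k of characteristic 0. Suppose that every 2-cocycle is a coboundary (H²_RBA(A) = 0): for every k-bilinear f : A × A → A and k-linear g : A → A satisfying (i) a·f(b,c) − f(a·b,c) + f(a,b·c) − f(a,b)·c = 0 for all a,b,c, and (ii) T(a)·g(b) − T(a·g(b)) − g(a·T(b)) − g(T(a)·b) − λg(a·b) + g(a)·T(b) − T(g(a)·b) + f(T(a),T(b)) − T(f(a,T(b))) − T(f(T(a),b)) − λT(f(a,b)) = 0 for all a,b, there exist a k-linear map h : A → A and an element x ∈ A such that f(a,b) = a·h(b) − h(a·b) + h(a)·b and g(a) = T(a)·x − T(a·x) − x·T(a) + T(x·a) − h(T(a)) + T(h(a)) for all a,b. Then (A,·,T) is rigid: for every 1-parameter formal deformation (μ_i, T_i)_{i≥0} of (A,·,T) there exist k-linear maps ψ_i : A → A (i ≥ 0) with ψ₀ = id_A such that for all n ≥ 0 and a, b ∈ A: Σ_{i+j=n} ψ_i(μ_j(a,b)) = Σ_{i+j=n} ψ_i(a)·ψ_j(b) and Σ_{i+j=n} ψ_i(T_j(a)) = T(ψ_n(a)), i.e.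 the deformation is equivalent to the trivial one. -/
namespace FormalDeformation

open Finset

theorem sum_antidiagonal_assoc {M : Type*} [AddCommMonoid M] (f : ℕ → ℕ → ℕ → M) (n : ℕ) :
    ∑ p ∈ antidiagonal n, ∑ q ∈ antidiagonal p.2, f p.1 q.1 q.2
      = ∑ p ∈ antidiagonal n, ∑ q ∈ antidiagonal p.1, f q.1 q.2 p.2 := by
  rw [sum_sigma', sum_sigma']
  refine sum_nbij' (fun x => ⟨(x.1.1 + x.2.1, x.2.2), (x.1.1, x.2.1)⟩)
    (fun x => ⟨(x.2.1, x.2.2 + x.1.2), (x.2.2, x.1.2)⟩) ?_ ?_ ?_ ?_ ?_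
  all_goals
    rintro ⟨⟨a, b⟩, ⟨c, d⟩⟩ h
    simp only [mem_sigma, HasAntidiagonal.mem_antidiagonal] at h ⊢
  all_goals obtain ⟨rfl, rfl⟩ := h
  all_goals simp [add_assoc]

theorem sum_antidiagonal_comm₄ {M : Type*} [AddCommMonoid M] (f : ℕ → ℕ → ℕ → ℕ → M) (n : ℕ) :
    ∑ p ∈ antidiagonal n, ∑ q ∈ antidiagonal p.1, ∑ r ∈ antidiagonal p.2, f q.1 q.2 r.1 r.2
      = ∑ p ∈ antidiagonal n, ∑ q ∈ antidiagonal p.1, ∑ r ∈ antidiagonal p.2,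
          f q.1 r.1 q.2 r.2 := by
  simp only [← sum_product']
  rw [sum_sigma', sum_sigma']
  refine sum_nbij'
    (fun x => ⟨(x.2.1.1 + x.2.2.1, x.2.1.2 + x.2.2.2),
      ((x.2.1.1, x.2.2.1), (x.2.1.2, x.2.2.2))⟩)
    (fun x => ⟨(x.2.1.1 + x.2.2.1, x.2.1.2 + x.2.2.2),
      ((x.2.1.1, x.2.2.1), (x.2.1.2, x.2.2.2))⟩) ?_ ?_ ?_ ?_ ?_
  all_goals
    rintro ⟨⟨a, b⟩, ⟨⟨c, d⟩, ⟨e, f⟩⟩⟩ h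
    simp only [mem_sigma, mem_product, HasAntidiagonal.mem_antidiagonal] at h ⊢
  all_goals obtain ⟨rfl, rfl, rfl⟩ := h
  all_goals simp [add_add_add_comm]

/-- A sequence whose `n`-th term can be chosen, once the conditions of index `< n` hold, so as to
satisfy the `n`-th condition, where the latter only involves the terms of index `≤ n`. -/
theorem exists_seq_of_step {X : Type*} [Inhabited X] (Q : ℕ → (ℕ → X) → Prop)
    (congr : ∀ n u v, (∀ m ≤ n, u m = v m) → Q n u → Q n v)
    (step : ∀ n u, (∀ m < n, Q m u) → ∃ x, Q n (Function.update u n x)) :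
    ∃ u, ∀ n, Q n u := by
  choose! s hs using step
  let U : ℕ → ℕ → X := fun n =>
    Nat.rec (fun _ => default) (fun n u => Function.update u n (s n u)) n
  have U_succ (n : ℕ) : U (n + 1) = Function.update (U n) n (s n (U n)) := rfl
  have stable (m d : ℕ) : U (m + 1 + d) m = U (m + 1) m := by
    induction d with
    | zero => rfl
    | succ d ih =>
      rw [← add_assoc, U_succ, Function.update_of_ne (by omega), ih]
  have stable' (m n : ℕ) (h : m < n) : U n m = U (m + 1) m := by
    obtain ⟨d, rfl⟩ := Nat.exists_eq_add_of_le (Nat.succ_le_of_lt h)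
    exact stable m d
  refine ⟨fun n => U (n + 1) n, fun n => ?_⟩
  induction n using Nat.strong_induction_on with
  | _ n ih =>
    have h := hs n (U n) fun m hm =>
      congr m _ _ (fun l hl => (stable' l n (by omega)).symm) (ih m hm)
    exact congr n _ _ (fun l hl => stable' l (n + 1) (by omega)) h

section Modules

variable {k A : Type*} [CommSemiring k] [AddCommMonoid A] [Module k A]

/-- The `k⟦t⟧`-linear extension of `∑ φ i t ^ i` to formal power series with coefficients
in `A`. -/
def extend (φ : ℕ → A →ₗ[k] A) (u : ℕ → A) (n : ℕ) : A :=
  ∑ p ∈ antidiagonal n, φ p.1 (u p.2)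

/-- The `k⟦t⟧`-bilinear extension of `∑ μ i t ^ i` to formal power series with coefficients
in `A`. -/
def extend₂ (μ : ℕ → A →ₗ[k] A →ₗ[k] A) (u v : ℕ → A) (n : ℕ) : A :=
  ∑ p ∈ antidiagonal n, ∑ q ∈ antidiagonal p.2, μ p.1 (u q.1) (v q.2)

theorem sum_antidiagonal_single_left {X Y : Type*} [AddCommMonoid X] [AddCommMonoid Y]
    (f : X → ℕ → Y) (hf : ∀ m, f 0 m = 0) (a : X) (n : ℕ) :
    ∑ p ∈ antidiagonal n, f ((Pi.single 0 a : ℕ → X) p.1) p.2 = f a n := by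
  rw [sum_eq_single (0, n)]
  · simp
  · rintro ⟨i, j⟩ h hne
    have : i ≠ 0 := by
      rintro rfl
      simp_all
    simp [this, hf]
  · simp

theorem sum_antidiagonal_single_right {X Y : Type*} [AddCommMonoid X] [AddCommMonoid Y]
    (f : ℕ → X → Y) (hf : ∀ m, f m 0 = 0) (a : X) (n : ℕ) :
    ∑ p ∈ antidiagonal n, f p.1 ((Pi.single 0 a : ℕ → X) p.2) = f n a := by
  rw [← Nat.sum_antidiagonal_swap]
  exact sum_antidiagonal_single_left (fun x m => f m x) hf a n

theorem extend_single (φ : ℕ → A →ₗ[k] A) (a : A) (n : ℕ) :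
    extend φ (Pi.single 0 a) n = φ n a :=
  sum_antidiagonal_single_right (fun m x => φ m x) (by simp) a n

theorem extend₂_single_right (μ : ℕ → A →ₗ[k] A →ₗ[k] A) (u : ℕ → A) (b : A) (n : ℕ) :
    extend₂ μ u (Pi.single 0 b) n = ∑ p ∈ antidiagonal n, μ p.1 (u p.2) b :=
  sum_congr rfl fun p _ =>
    sum_antidiagonal_single_right (fun m x => μ p.1 (u m) x) (by simp) b p.2

theorem extend₂_single_left (μ : ℕ → A →ₗ[k] A →ₗ[k] A) (a : A) (v : ℕ → A) (n : ℕ) :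
    extend₂ μ (Pi.single 0 a) v n = ∑ p ∈ antidiagonal n, μ p.1 a (v p.2) :=
  sum_congr rfl fun p _ =>
    sum_antidiagonal_single_left (fun x m => μ p.1 x (v m)) (by simp) a p.2

theorem extend₂_single_single (μ : ℕ → A →ₗ[k] A →ₗ[k] A) (a b : A) (n : ℕ) :
    extend₂ μ (Pi.single 0 a) (Pi.single 0 b) n = μ n a b := by
  rw [extend₂_single_left]
  exact sum_antidiagonal_single_right (fun m x => μ m a x) (by simp) b n

theorem extend_zero (φ : ℕ → A →ₗ[k] A) (u : ℕ → A) : extend φ u 0 = φ 0 (u 0) := by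
  simp [extend]

theorem extend₂_zero (μ : ℕ → A →ₗ[k] A →ₗ[k] A) (u v : ℕ → A) :
    extend₂ μ u v 0 = μ 0 (u 0) (v 0) := by
  simp [extend₂]

theorem sum_antidiagonal_eq_left {Y : Type*} [AddCommMonoid Y] {f : ℕ → ℕ → Y} {n : ℕ}
    (h : ∀ i < n, ∀ j, f i j = 0) : ∑ p ∈ antidiagonal n, f p.1 p.2 = f n 0 := by
  rw [sum_eq_single (n, 0)]
  · rintro ⟨i, j⟩ hij hne
    rw [HasAntidiagonal.mem_antidiagonal] at hij
    refine h i (lt_of_le_of_ne (by omega) ?_) j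
    rintro rfl
    simp_all
  · simp

theorem extend_eq_of_lt {φ : ℕ → A →ₗ[k] A} {n : ℕ} (h : ∀ m < n, φ m = 0) (u : ℕ → A) :
    extend φ u n = φ n (u 0) :=
  sum_antidiagonal_eq_left (f := fun i j => φ i (u j)) fun i hi j => by simp [h i hi]

theorem extend₂_eq_of_lt {μ : ℕ → A →ₗ[k] A →ₗ[k] A} {n : ℕ} (h : ∀ m < n, μ m = 0)
    (u v : ℕ → A) : extend₂ μ u v n = μ n (u 0) (v 0) := by
  have := sum_antidiagonal_eq_left (n := n)
    (f := fun i j => ∑ q ∈ antidiagonal j, μ i (u q.1) (v q.2)) fun i hi j => by simp [h i hi]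
  simpa [extend₂] using this

theorem extend_extend (φ χ : ℕ → A →ₗ[k] A) (u : ℕ → A) :
    extend φ (extend χ u) = extend (fun n => ∑ p ∈ antidiagonal n, φ p.1 ∘ₗ χ p.2) u := by
  ext n
  simpa [extend] using sum_antidiagonal_assoc (fun a b c => φ a (χ b (u c))) n

theorem extend_extend₂ (φ : ℕ → A →ₗ[k] A) (μ : ℕ → A →ₗ[k] A →ₗ[k] A) (u v : ℕ → A) :
    extend φ (extend₂ μ u v)
      = extend₂ (fun n => ∑ p ∈ antidiagonal n, (μ p.2).compr₂ (φ p.1)) u v := by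
  ext n
  have := sum_antidiagonal_assoc
    (fun a b c => ∑ r ∈ antidiagonal c, φ a (μ b (u r.1) (v r.2))) n
  simp only [extend, extend₂, map_sum, LinearMap.sum_apply, LinearMap.compr₂_apply]
  rw [this]
  exact sum_congr rfl fun p _ => sum_comm

end Modules

section Rings

variable {A : Type*} [NonUnitalRing A]

/-- The Cauchy product of formal power series with coefficients in `A`. -/
def cauchyMul (u v : ℕ → A) (n : ℕ) : A :=
  ∑ p ∈ antidiagonal n, u p.1 * v p.2

theorem cauchyMul_assoc (u v w : ℕ → A) :
    cauchyMul (cauchyMul u v) w = cauchyMul u (cauchyMul v w) := by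
  ext n
  simpa [cauchyMul, sum_mul, mul_sum, mul_assoc] using
    (sum_antidiagonal_assoc (fun a b c => u a * (v b * w c)) n).symm

theorem cauchyMul_add (u v w : ℕ → A) :
    cauchyMul u (v + w) = cauchyMul u v + cauchyMul u w := by
  ext n
  simp [cauchyMul, mul_add, sum_add_distrib]

theorem add_cauchyMul (u v w : ℕ → A) :
    cauchyMul (u + v) w = cauchyMul u w + cauchyMul v w := by
  ext n
  simp [cauchyMul, add_mul, sum_add_distrib]

theorem cauchyMul_eq_of_lt_left {u : ℕ → A} {n : ℕ} (h : ∀ m < n, u m = 0) (v : ℕ → A) :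
    cauchyMul u v n = u n * v 0 :=
  sum_antidiagonal_eq_left (f := fun i j => u i * v j) fun i hi j => by simp [h i hi]

theorem cauchyMul_eq_of_lt_right {v : ℕ → A} {n : ℕ} (h : ∀ m < n, v m = 0) (u : ℕ → A) :
    cauchyMul u v n = u 0 * v n := by
  rw [cauchyMul, ← Nat.sum_antidiagonal_swap]
  exact sum_antidiagonal_eq_left (f := fun i j => u j * v i) fun i hi j => by simp [h i hi]

variable {k : Type*} [CommRing k] [Module k A] [SMulCommClass k A A] [IsScalarTower k A A]

theorem cauchyMul_extend (φ χ : ℕ → A →ₗ[k] A) (u v : ℕ → A) :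
    cauchyMul (extend φ u) (extend χ v)
      = extend₂ (fun n => ∑ p ∈ antidiagonal n, (LinearMap.mul k A).compl₁₂ (φ p.1) (χ p.2))
          u v := by
  ext n
  have := sum_antidiagonal_comm₄ (fun a b c d => φ a (u b) * χ c (v d)) n
  simp only [cauchyMul, extend, extend₂, sum_mul_sum, LinearMap.sum_apply,
    LinearMap.compl₁₂_apply, LinearMap.mul_apply']
  rw [this]
  exact sum_congr rfl fun p _ => sum_comm

/-- The failure of `∑ ψ i t ^ i` to be multiplicative from `∑ μ i t ^ i` to the undeformed
product. -/
def mulDefect (ψ : ℕ → A →ₗ[k] A) (μ : ℕ → A →ₗ[k] A →ₗ[k] A) (n : ℕ) : A →ₗ[k] A →ₗ[k] A :=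
  ∑ p ∈ antidiagonal n, (μ p.2).compr₂ (ψ p.1)
    - ∑ p ∈ antidiagonal n, (LinearMap.mul k A).compl₁₂ (ψ p.1) (ψ p.2)

/-- The failure of `∑ ψ i t ^ i` to intertwine `∑ S i t ^ i` with the undeformed operator `T`. -/
def opDefect (T : A →ₗ[k] A) (ψ S : ℕ → A →ₗ[k] A) (n : ℕ) : A →ₗ[k] A :=
  ∑ p ∈ antidiagonal n, ψ p.1 ∘ₗ S p.2 - T ∘ₗ ψ n

theorem mulDefect_apply (ψ : ℕ → A →ₗ[k] A) (μ : ℕ → A →ₗ[k] A →ₗ[k] A) (n : ℕ) (a b : A) :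
    mulDefect ψ μ n a b = ∑ p ∈ antidiagonal n, ψ p.1 (μ p.2 a b)
      - ∑ p ∈ antidiagonal n, ψ p.1 a * ψ p.2 b := by
  simp [mulDefect]

omit [SMulCommClass k A A] [IsScalarTower k A A] in
theorem opDefect_apply (T : A →ₗ[k] A) (ψ S : ℕ → A →ₗ[k] A) (n : ℕ) (a : A) :
    opDefect T ψ S n a = ∑ p ∈ antidiagonal n, ψ p.1 (S p.2 a) - T (ψ n a) := by
  simp [opDefect]

theorem extend_extend₂_eq_add_mulDefect (ψ : ℕ → A →ₗ[k] A) (μ : ℕ → A →ₗ[k] A →ₗ[k] A)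
    (u v : ℕ → A) :
    extend ψ (extend₂ μ u v)
      = cauchyMul (extend ψ u) (extend ψ v) + extend₂ (mulDefect ψ μ) u v := by
  rw [extend_extend₂, cauchyMul_extend]
  ext n
  simp [extend₂, mulDefect]

omit [SMulCommClass k A A] [IsScalarTower k A A] in
theorem extend_extend_eq_add_opDefect (T : A →ₗ[k] A) (ψ S : ℕ → A →ₗ[k] A) (u : ℕ → A) :
    extend ψ (extend S u) = T ∘ extend ψ u + extend (opDefect T ψ S) u := by
  rw [extend_extend]
  ext n
  simp [extend, opDefect]

theorem defect_congr (T : A →ₗ[k] A) (μ : ℕ → A →ₗ[k] A →ₗ[k] A) (S : ℕ → A →ₗ[k] A)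
    {ψ χ : ℕ → A →ₗ[k] A} {n : ℕ} (h : ∀ m ≤ n, ψ m = χ m) :
    mulDefect ψ μ n = mulDefect χ μ n ∧ opDefect T ψ S n = opDefect T χ S n := by
  have h₁ : ∀ p ∈ antidiagonal n, ψ p.1 = χ p.1 := fun p hp =>
    h _ (by rw [HasAntidiagonal.mem_antidiagonal] at hp; omega)
  have h₂ : ∀ p ∈ antidiagonal n, ψ p.2 = χ p.2 := fun p hp =>
    h _ (by rw [HasAntidiagonal.mem_antidiagonal] at hp; omega)
  constructor
  · exact congrArg₂ _ (sum_congr rfl fun p hp => by rw [h₁ p hp])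
      (sum_congr rfl fun p hp => by rw [h₁ p hp, h₂ p hp])
  · exact congrArg₂ _ (sum_congr rfl fun p hp => by rw [h₁ p hp]) (by rw [h n le_rfl])

theorem sum_antidiagonal_update_left {X Y : Type*} [AddCommGroup Y] (f : X → ℕ → Y)
    (u : ℕ → X) (n : ℕ) (x : X) :
    ∑ p ∈ antidiagonal n, f (Function.update u n x p.1) p.2
      = ∑ p ∈ antidiagonal n, f (u p.1) p.2 + (f x 0 - f (u n) 0) := by
  have := sum_antidiagonal_eq_left (n := n)
    (f := fun i j => f (Function.update u n x i) j - f (u i) j)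
    fun i hi j => by simp [Function.update_of_ne hi.ne]
  rw [sum_sub_distrib, sub_eq_iff_eq_add'] at this
  simpa using this

theorem mulDefect_update {ψ : ℕ → A →ₗ[k] A} {μ : ℕ → A →ₗ[k] A →ₗ[k] A} {n : ℕ}
    (hψ : ψ 0 = LinearMap.id) (hμ : ∀ a b, μ 0 a b = a * b) (hn : 0 < n) (h : A →ₗ[k] A)
    (a b : A) :
    mulDefect (Function.update ψ n (ψ n + h)) μ n a b
      = mulDefect ψ μ n a b - (a * h b - h (a * b) + h a * b) := by
  have h₁ := sum_antidiagonal_update_left (fun φ j => φ (μ j a b)) ψ n (ψ n + h)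
  have h₂ := sum_antidiagonal_update_left
    (fun φ j => φ a * Function.update ψ n (ψ n + h) j b) ψ n (ψ n + h)
  have h₃ := sum_antidiagonal_update_left (fun φ j => ψ j a * φ b) ψ n (ψ n + h)
  rw [← Nat.sum_antidiagonal_swap, ← Nat.sum_antidiagonal_swap (n := n)
    (f := fun p => ψ p.2 a * ψ p.1 b)] at h₃
  simp only [Prod.fst_swap, Prod.snd_swap] at h₃
  simp only [mulDefect_apply, h₁, h₂, h₃, Function.update_of_ne hn.ne, hψ, hμ,
    LinearMap.add_apply, LinearMap.id_apply, add_mul, mul_add]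
  abel

omit [SMulCommClass k A A] [IsScalarTower k A A] in
theorem opDefect_update {T : A →ₗ[k] A} {ψ S : ℕ → A →ₗ[k] A} {n : ℕ} (hS : S 0 = T)
    (h : A →ₗ[k] A) (a : A) :
    opDefect T (Function.update ψ n (ψ n + h)) S n a
      = opDefect T ψ S n a - (T (h a) - h (T a)) := by
  have h₁ := sum_antidiagonal_update_left (fun φ j => φ (S j a)) ψ n (ψ n + h)
  simp only [opDefect_apply, h₁, Function.update_self, hS, LinearMap.add_apply, map_add]
  abel

theorem mulDefect_cocycle {ψ : ℕ → A →ₗ[k] A} {μ : ℕ → A →ₗ[k] A →ₗ[k] A} {n : ℕ}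
    (hψ : ψ 0 = LinearMap.id) (hμ : ∀ a b, μ 0 a b = a * b)
    (hassoc : ∀ (n : ℕ) (a b c : A),
      ∑ p ∈ antidiagonal n, μ p.1 (μ p.2 a b) c = ∑ p ∈ antidiagonal n, μ p.1 a (μ p.2 b c))
    (hF : ∀ m < n, mulDefect ψ μ m = 0) (a b c : A) :
    a * mulDefect ψ μ n b c - mulDefect ψ μ n (a * b) c + mulDefect ψ μ n a (b * c)
      - mulDefect ψ μ n a b * c = 0 := by
  have hF' (x y : ℕ → A) : ∀ m < n, extend₂ (mulDefect ψ μ) x y m = 0 := fun m hm => by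
    rw [extend₂_eq_of_lt (fun l hl => hF l (hl.trans hm)), hF m hm]; rfl
  set α : ℕ → A := Pi.single 0 a
  set β : ℕ → A := Pi.single 0 b
  set γ : ℕ → A := Pi.single 0 c
  have h : extend₂ μ (extend₂ μ α β) γ = extend₂ μ α (extend₂ μ β γ) := by
    ext m
    rw [extend₂_single_right, extend₂_single_left]
    simpa only [α, β, γ, extend₂_single_single] using hassoc m a b c
  have h' := congrFun (congrArg (extend ψ) h) n
  simp only [extend_extend₂_eq_add_mulDefect, add_cauchyMul, cauchyMul_add, cauchyMul_assoc,
    Pi.add_apply] at h'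
  rw [cauchyMul_eq_of_lt_left (hF' _ _), cauchyMul_eq_of_lt_right (hF' _ _)] at h'
  simp only [extend₂_eq_of_lt hF, extend_zero, extend₂_zero, hψ, hμ, α, β, γ, Pi.single_eq_same,
    LinearMap.id_apply] at h'
  rw [← neg_eq_zero, ← sub_eq_zero.mpr h']
  abel

theorem opDefect_cocycle {lam : k} {T : A →ₗ[k] A}
    (hT : ∀ a b : A, T a * T b = T (a * T b + T a * b + lam • (a * b)))
    {ψ S : ℕ → A →ₗ[k] A} {μ : ℕ → A →ₗ[k] A →ₗ[k] A} {n : ℕ}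
    (hψ : ψ 0 = LinearMap.id) (hμ : ∀ a b, μ 0 a b = a * b) (hS : S 0 = T)
    (hrb : ∀ (n : ℕ) (a b : A),
      ∑ p ∈ antidiagonal n, ∑ q ∈ antidiagonal p.2, μ p.1 (S q.1 a) (S q.2 b)
        = ∑ p ∈ antidiagonal n, ∑ q ∈ antidiagonal p.2, S p.1 (μ q.1 a (S q.2 b))
          + ∑ p ∈ antidiagonal n, ∑ q ∈ antidiagonal p.2, S p.1 (μ q.1 (S q.2 a) b)
          + lam • ∑ p ∈ antidiagonal n, S p.1 (μ p.2 a b))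
    (hn : 0 < n) (hF : ∀ m < n, mulDefect ψ μ m = 0) (hG : ∀ m < n, opDefect T ψ S m = 0)
    (a b : A) :
    T a * opDefect T ψ S n b - T (a * opDefect T ψ S n b) - opDefect T ψ S n (a * T b)
      - opDefect T ψ S n (T a * b) - lam • opDefect T ψ S n (a * b)
      + opDefect T ψ S n a * T b - T (opDefect T ψ S n a * b)
      + mulDefect ψ μ n (T a) (T b) - T (mulDefect ψ μ n a (T b))
      - T (mulDefect ψ μ n (T a) b) - lam • T (mulDefect ψ μ n a b) = 0 := by
  have hG' (x : ℕ → A) : ∀ m < n, extend (opDefect T ψ S) x m = 0 := fun m hm => by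
    rw [extend_eq_of_lt (fun l hl => hG l (hl.trans hm)), hG m hm]; rfl
  set α : ℕ → A := Pi.single 0 a
  set β : ℕ → A := Pi.single 0 b
  have h : extend₂ μ (extend S α) (extend S β)
      = extend S (extend₂ μ α (extend S β)) + extend S (extend₂ μ (extend S α) β)
        + lam • extend S (extend₂ μ α β) := by
    ext m
    have h₀ : extend₂ μ (extend S α) (extend S β) m
        = ∑ p ∈ antidiagonal m, ∑ q ∈ antidiagonal p.2, μ p.1 (S q.1 a) (S q.2 b) := by
      simp only [extend₂, extend_single, α, β]
    have h₁ : extend S (extend₂ μ α (extend S β)) m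
        = ∑ p ∈ antidiagonal m, ∑ q ∈ antidiagonal p.2, S p.1 (μ q.1 a (S q.2 b)) := by
      rw [extend]
      simp only [extend₂_single_left, extend_single, map_sum, α, β]
    have h₂ : extend S (extend₂ μ (extend S α) β) m
        = ∑ p ∈ antidiagonal m, ∑ q ∈ antidiagonal p.2, S p.1 (μ q.1 (S q.2 a) b) := by
      rw [extend]
      simp only [extend₂_single_right, extend_single, map_sum, α, β]
    have h₃ : extend S (extend₂ μ α β) m = ∑ p ∈ antidiagonal m, S p.1 (μ p.2 a b) := by
      simp only [extend, extend₂_single_single, α, β]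
    rw [Pi.add_apply, Pi.add_apply, Pi.smul_apply, h₀, h₁, h₂, h₃, hrb]
  have hadd (u v : ℕ → A) : extend ψ (u + v) = extend ψ u + extend ψ v := by
    ext m; simp [extend, sum_add_distrib]
  have hsmul (u : ℕ → A) : extend ψ (lam • u) = lam • extend ψ u := by
    ext m; simp [extend, smul_sum]
  have hT' : cauchyMul (T ∘ extend ψ α) (T ∘ extend ψ β) n
      = T (cauchyMul (extend ψ α) (T ∘ extend ψ β) n)
        + T (cauchyMul (T ∘ extend ψ α) (extend ψ β) n)
        + lam • T (cauchyMul (extend ψ α) (extend ψ β) n) := by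
    simp [cauchyMul, hT, sum_add_distrib, smul_sum]
  have h' := congrFun (congrArg (extend ψ) h) n
  simp only [hadd, hsmul, extend_extend_eq_add_opDefect T ψ,
    extend_extend₂_eq_add_mulDefect ψ,
    add_cauchyMul, cauchyMul_add, Pi.add_apply, Pi.smul_apply, Function.comp_apply, map_add,
    smul_add] at h'
  rw [hT'] at h'
  simp only [cauchyMul_eq_of_lt_left (hG' _), cauchyMul_eq_of_lt_right (hG' _), hG' _ 0 hn] at h'
  simp only [extend₂_eq_of_lt hF, extend_eq_of_lt hG, extend_zero, extend₂_zero, hψ, hμ, hS, α, β,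
    Pi.single_eq_same, LinearMap.id_apply, Function.comp_apply] at h'
  simp only [mul_zero, add_zero] at h'
  rw [← sub_eq_zero.mpr h']
  abel

end Rings

end FormalDeformation

open Finset in
/-- If `H²_RBA(A) = 0` (every 2-cocycle of the Rota-Baxter algebra `(A, ·, T)` is a
coboundary), then `(A, ·, T)` is rigid: every 1-parameter formal deformation is
equivalent to the trivial one. -/
theorem rigid_of_H2_eq_zero {k A : Type*} [Field k] [CharZero k]
    [NonUnitalRing A] [Module k A] [SMulCommClass k A A] [IsScalarTower k A A]
    (lam : k) (T : A →ₗ[k] A)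
    (hT : ∀ a b : A, T a * T b = T (a * T b + T a * b + lam • (a * b)))
    (hH2 : ∀ (f : A →ₗ[k] A →ₗ[k] A) (g : A →ₗ[k] A),
      (∀ a b c : A, a * f b c - f (a * b) c + f a (b * c) - f a b * c = 0) →
      (∀ a b : A,
        T a * g b - T (a * g b) - g (a * T b) - g (T a * b) - lam • g (a * b)
          + g a * T b - T (g a * b)
          + f (T a) (T b) - T (f a (T b)) - T (f (T a) b) - lam • T (f a b) = 0) →
      ∃ (h : A →ₗ[k] A) (x : A),
        (∀ a b : A, f a b = a * h b - h (a * b) + h a * b) ∧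
        (∀ a : A, g a = T a * x - T (a * x) - x * T a + T (x * a) - h (T a) + T (h a)))
    (μ : ℕ → A →ₗ[k] A →ₗ[k] A) (Td : ℕ → A →ₗ[k] A)
    (hμ0 : ∀ a b : A, μ 0 a b = a * b) (hT0 : Td 0 = T)
    (hassoc : ∀ (n : ℕ) (a b c : A),
      ∑ p ∈ antidiagonal n, μ p.1 (μ p.2 a b) c
        = ∑ p ∈ antidiagonal n, μ p.1 a (μ p.2 b c))
    (hrb : ∀ (n : ℕ) (a b : A),
      ∑ p ∈ antidiagonal n, ∑ q ∈ antidiagonal p.2, μ p.1 (Td q.1 a) (Td q.2 b)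
        = ∑ p ∈ antidiagonal n, ∑ q ∈ antidiagonal p.2, Td p.1 (μ q.1 a (Td q.2 b))
          + ∑ p ∈ antidiagonal n, ∑ q ∈ antidiagonal p.2, Td p.1 (μ q.1 (Td q.2 a) b)
          + lam • ∑ p ∈ antidiagonal n, Td p.1 (μ p.2 a b)) :
    ∃ ψ : ℕ → A →ₗ[k] A, ψ 0 = LinearMap.id ∧
      (∀ (n : ℕ) (a b : A),
        ∑ p ∈ antidiagonal n, ψ p.1 (μ p.2 a b)
          = ∑ p ∈ antidiagonal n, ψ p.1 a * ψ p.2 b) ∧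
      (∀ (n : ℕ) (a : A),
        ∑ p ∈ antidiagonal n, ψ p.1 (Td p.2 a) = T (ψ n a)) := by
  have hH2' (f : A →ₗ[k] A →ₗ[k] A) (g : A →ₗ[k] A)
      (hf : ∀ a b c : A, a * f b c - f (a * b) c + f a (b * c) - f a b * c = 0)
      (hg : ∀ a b : A,
        T a * g b - T (a * g b) - g (a * T b) - g (T a * b) - lam • g (a * b)
          + g a * T b - T (g a * b)
          + f (T a) (T b) - T (f a (T b)) - T (f (T a) b) - lam • T (f a b) = 0) :
      ∃ h : A →ₗ[k] A, (∀ a b : A, f a b = a * h b - h (a * b) + h a * b) ∧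
        ∀ a : A, g a = T (h a) - h (T a) := by
    obtain ⟨h, x, h₁, h₂⟩ := hH2 f g hf hg
    refine ⟨h + LinearMap.mulLeft k x - LinearMap.mulRight k x, fun a b => ?_, fun a => ?_⟩
    · rw [h₁]
      simp only [LinearMap.sub_apply, LinearMap.add_apply, LinearMap.mulLeft_apply,
        LinearMap.mulRight_apply, mul_add, mul_sub, add_mul, sub_mul, mul_assoc]
      abel
    · rw [h₂]
      simp only [LinearMap.sub_apply, LinearMap.add_apply, LinearMap.mulLeft_apply,
        LinearMap.mulRight_apply, map_add, map_sub]
      abel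
  obtain ⟨ψ, hψ⟩ := FormalDeformation.exists_seq_of_step
    (fun n (ψ : ℕ → A →ₗ[k] A) => ψ 0 = LinearMap.id ∧
      FormalDeformation.mulDefect ψ μ n = 0 ∧ FormalDeformation.opDefect T ψ Td n = 0)
    (fun n u v huv => by
      rintro ⟨h₀, h₁, h₂⟩
      obtain ⟨e₁, e₂⟩ := FormalDeformation.defect_congr T μ Td huv
      exact ⟨huv 0 n.zero_le ▸ h₀, e₁ ▸ h₁, e₂ ▸ h₂⟩)
    (fun n u hu => by
      rcases n.eq_zero_or_pos with rfl | hn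
      · refine ⟨LinearMap.id, by simp, ?_, ?_⟩
        · ext a b
          simp [FormalDeformation.mulDefect_apply, hμ0]
        · ext a
          simp [FormalDeformation.opDefect_apply, hT0]
      · have h₀ := (hu 0 hn).1
        have hF : ∀ m < n, FormalDeformation.mulDefect u μ m = 0 := fun m hm => (hu m hm).2.1
        have hG : ∀ m < n, FormalDeformation.opDefect T u Td m = 0 := fun m hm => (hu m hm).2.2
        obtain ⟨h, h₁, h₂⟩ := hH2' _ _
          (FormalDeformation.mulDefect_cocycle h₀ hμ0 hassoc hF)
          (FormalDeformation.opDefect_cocycle hT h₀ hμ0 hT0 hrb hn hF hG)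
        refine ⟨u n + h, by rw [Function.update_of_ne hn.ne, h₀], ?_, ?_⟩
        · ext a b
          rw [FormalDeformation.mulDefect_update h₀ hμ0 hn, h₁]
          simp
        · ext a
          rw [FormalDeformation.opDefect_update hT0, h₂]
          simp)
  refine ⟨ψ, (hψ 0).1, fun n a b => ?_, fun n a => ?_⟩
  · rw [← sub_eq_zero, ← FormalDeformation.mulDefect_apply, (hψ n).2.1]
    rfl
  · rw [← sub_eq_zero, ← FormalDeformation.opDefect_apply, (hψ n).2.2]
    rfl
end

section
/- Let (A,·,T) and (Â,·,T̂) be Rota-Baxter algebras of weight λ over a field k of characteristic 0, p : Â → A a surjective k-algebra homomorphism with p∘T̂ = T∘p, and M := ker p; assume mm′ = 0 for all m, m′ ∈ M and T̂(M) ⊆ M, and write T_M := T̂|_M. Let s : A → Â be a k-linear section of p (p∘s = id_A), and for a ∈ A, m ∈ M set a·m := s(a)m and m·a := m s(a) (these lie in M). Then these actions make M an A-bimodule: (ab)·m = a·(b·m), m·(ab) = (m·a)·b, (a·m)·b = a·(m·b) for all a, b ∈ A, m ∈ M; and (M, T_M) is a Rota-Baxter bimodule over (A,·,T): T(a)·T_M(m)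 = T_M(a·T_M(m) + T(a)·m + λ a·m) and T_M(m)·T(a) = T_M(m·T(a) + T_M(m)·a + λ m·a). -/
/-- In an abelian extension `0 → M → B → A → 0` of Rota-Baxter algebras (where `M = ker p`
has zero multiplication), a linear section `s` of `p` induces on `M` the structure of a
Rota-Baxter bimodule over `(A, ·, T)` via `a·m := s(a)m` and `m·a := m s(a)`. -/
theorem abelianExtension_inducedBimodule {k A B : Type*} [Field k] [CharZero k]
    [NonUnitalRing A] [Module k A] [SMulCommClass k A A] [IsScalarTower k A A]
    [NonUnitalRing B] [Module k B] [SMulCommClass k B B] [IsScalarTower k B B]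
    (lam : k) (T : A →ₗ[k] A) (Th : B →ₗ[k] B)
    (hT : ∀ a b : A, T a * T b = T (a * T b + T a * b + lam • (a * b)))
    (hTh : ∀ x y : B, Th x * Th y = Th (x * Th y + Th x * y + lam • (x * y)))
    (p : B →ₗ[k] A) (hpmul : ∀ x y : B, p (x * y) = p x * p y)
    (hpsurj : Function.Surjective p)
    (hpT : ∀ x : B, p (Th x) = T (p x))
    (hMzero : ∀ m m' : B, p m = 0 → p m' = 0 → m * m' = 0)
    (hThM : ∀ m : B, p m = 0 → p (Th m) = 0)
    (s : A →ₗ[k] B) (hs : ∀ a : A, p (s a) = a) :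
    (∀ (a : A) (m : B), p m = 0 → p (s a * m) = 0 ∧ p (m * s a) = 0) ∧
    (∀ (a b : A) (m : B), p m = 0 → s (a * b) * m = s a * (s b * m)) ∧
    (∀ (a b : A) (m : B), p m = 0 → m * s (a * b) = (m * s a) * s b) ∧
    (∀ (a b : A) (m : B), p m = 0 → (s a * m) * s b = s a * (m * s b)) ∧
    (∀ (a : A) (m : B), p m = 0 →
      s (T a) * Th m = Th (s a * Th m + s (T a) * m + lam • (s a * m))) ∧
    (∀ (a : A) (m : B), p m = 0 →
      Th m * s (T a) = Th (m * s (T a) + Th m * s a + lam • (m * s a))) := by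
  have left_congr : ∀ x y m : B, p x = p y → p m = 0 → x * m = y * m := fun x y m hxy hm =>
    sub_eq_zero.mp <| by
      rw [← sub_mul]
      exact hMzero _ _ (by rw [map_sub, hxy, sub_self]) hm
  have right_congr : ∀ x y m : B, p x = p y → p m = 0 → m * x = m * y := fun x y m hxy hm =>
    sub_eq_zero.mp <| by
      rw [← mul_sub]
      exact hMzero _ _ hm (by rw [map_sub, hxy, sub_self])
  have p_section_mul : ∀ a b : A, p (s (a * b)) = p (s a * s b) := fun a b => by
    rw [hpmul, hs, hs, hs]
  have p_section_T : ∀ a : A, p (s (T a)) = p (Th (s a)) := fun a => by rw [hpT, hs, hs]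
  refine ⟨fun a m hm => ⟨?_, ?_⟩, fun a b m hm => ?_, fun a b m hm => ?_,
    fun a b m _ => mul_assoc _ _ _, fun a m hm => ?_, fun a m hm => ?_⟩
  · rw [hpmul, hm, mul_zero]
  · rw [hpmul, hm, zero_mul]
  · rw [left_congr _ _ m (p_section_mul a b) hm, mul_assoc]
  · rw [right_congr _ _ m (p_section_mul a b) hm, mul_assoc]
  · rw [left_congr _ _ (Th m) (p_section_T a) (hThM m hm), left_congr _ _ m (p_section_T a) hm, hTh]
  · rw [right_congr _ _ (Th m) (p_section_T a) (hThM m hm),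
      right_congr _ _ m (p_section_T a) hm, hTh]
end

section
/- Let (A,·,T) and (Â,·,T̂) be Rota-Baxter algebras of weight λ over a field k of characteristic 0, p : Â → A a surjective k-algebra homomorphism with p∘T̂ = T∘p, M := ker p with mm′ = 0 for all m, m′ ∈ M and T̂(M) ⊆ M, T_M := T̂|_M, and s : A → Â a k-linear section of p; equip M with the A-bimodule structure a·m := s(a)m, m·a := m s(a). Define ψ(a,b) := s(a)s(b) − s(ab) ∈ M and χ(a) := T̂(s(a)) − s(T(a)) ∈ M. Then (ψ, χ) is a 2-cocycle of (A,·,T) with coefficients in (M,T_M): for all a, b, c ∈ A, a·ψ(b,c) − ψ(ab, c) + ψ(a, bc) − ψ(a,b)·c = 0, and T(a)·χ(b) + χ(a)·T(b) + ψ(T(a),T(b)) = T_M(χ(a)·b) + T_M(ψ(T(a),b)) + χ(T(a)b) + T_M(a·χ(b)) + T_M(ψ(a,T(b))) + χ(aT(b)) + λT_M(ψ(a,b)) + λχ(ab). -/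
/-- In an abelian extension of Rota-Baxter algebras with a chosen section `s`, the pair
`(ψ, χ)` given by `ψ(a,b) := s(a)s(b) − s(ab)` and `χ(a) := T̂(s(a)) − s(T(a))` is a
2-cocycle of `(A, ·, T)` with coefficients in the induced Rota-Baxter bimodule
`(M, T_M)`. -/
theorem abelianExtension_twoCocycle {k A B : Type*} [Field k] [CharZero k]
    [NonUnitalRing A] [Module k A] [SMulCommClass k A A] [IsScalarTower k A A]
    [NonUnitalRing B] [Module k B] [SMulCommClass k B B] [IsScalarTower k B B]
    (lam : k) (T : A →ₗ[k] A) (Th : B →ₗ[k] B)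
    (hT : ∀ a b : A, T a * T b = T (a * T b + T a * b + lam • (a * b)))
    (hTh : ∀ x y : B, Th x * Th y = Th (x * Th y + Th x * y + lam • (x * y)))
    (p : B →ₗ[k] A) (hpmul : ∀ x y : B, p (x * y) = p x * p y)
    (hpsurj : Function.Surjective p)
    (hpT : ∀ x : B, p (Th x) = T (p x))
    (hMzero : ∀ m m' : B, p m = 0 → p m' = 0 → m * m' = 0)
    (hThM : ∀ m : B, p m = 0 → p (Th m) = 0)
    (s : A →ₗ[k] B) (hs : ∀ a : A, p (s a) = a)
    (ψ : A → A → B) (hψ : ∀ a b : A, ψ a b = s a * s b - s (a * b))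
    (χ : A → B) (hχ : ∀ a : A, χ a = Th (s a) - s (T a)) :
    (∀ a b c : A,
      s a * ψ b c - ψ (a * b) c + ψ a (b * c) - ψ a b * s c = 0) ∧
    (∀ a b : A,
      s (T a) * χ b + χ a * s (T b) + ψ (T a) (T b)
        = Th (χ a * s b) + Th (ψ (T a) b) + χ (T a * b)
          + Th (s a * χ b) + Th (ψ a (T b)) + χ (a * T b)
          + lam • Th (ψ a b) + lam • χ (a * b)) := by
  refine ⟨fun a b c => ?_, fun a b => ?_⟩
  · simp only [hψ, mul_sub, sub_mul, mul_assoc]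
    abel
  · have hχker : ∀ a : A, p (χ a) = 0 := fun a => by
      rw [hχ, map_sub, hpT, hs, hs, sub_self]
    have hχχ : χ a * χ b = 0 := hMzero _ _ (hχker a) (hχker b)
    have hlhs : s (T a) * χ b + χ a * s (T b) + ψ (T a) (T b)
        = Th (s a) * Th (s b) - s (T a * T b) := by
      rw [← sub_zero (s (T a) * χ b + χ a * s (T b) + ψ (T a) (T b)),
        ← neg_zero, ← hχχ]
      simp only [hψ, hχ, mul_sub, sub_mul]
      abel
    rw [hlhs, hTh, hT]
    simp only [hψ, hχ, mul_sub, sub_mul, map_add, map_sub, map_smul, smul_sub]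
    abel
end

section
/- Let (A,·,T) and (Â,·,T̂) be Rota-Baxter algebras of weight λ over a field k of characteristic 0, p : Â → A a surjective k-algebra homomorphism with p∘T̂ = T∘p, M := ker p with mm′ = 0 for all m, m′ ∈ M and T̂(M) ⊆ M, T_M := T̂|_M. Let s₁, s₂ : A → Â be two k-linear sections of p and γ := s₁ − s₂ : A → M. Then: (i) s₁(a)m = s₂(a)m and m s₁(a) = m s₂(a) for all a ∈ A, m ∈ M, i.e. the induced A-bimodule structure on M is independent of the section; (ii) writing ψ_j(a,b) := s_j(a)s_j(b) − s_j(ab) and χ_j(a) := T̂(s_j(a)) − s_j(T(a)) for j = 1, 2, one has ψ₁(a,b) = ψ₂(a,b) + a·γ(b) + γ(a)·b − γ(ab) and χ₁(a) = χ₂(a) + T_M(γ(a)) − γ(T(a)) for all a, b ∈ A (where a·m := s₂(a)m, m·a := m s₂(a)); hence the cohomology class of (ψ, χ) does not depend on the choice of the section. -/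
/-- Different choices of section of an abelian extension of Rota-Baxter algebras give the
same induced bimodule structure on `M = ker p`, and cohomologous cocycles `(ψ, χ)`:
the cocycles associated with two sections differ by the coboundary of `γ := s₁ − s₂`. -/
theorem abelianExtension_section_independence {k A B : Type*} [Field k] [CharZero k]
    [NonUnitalRing A] [Module k A] [SMulCommClass k A A] [IsScalarTower k A A]
    [NonUnitalRing B] [Module k B] [SMulCommClass k B B] [IsScalarTower k B B]
    (lam : k) (T : A →ₗ[k] A) (Th : B →ₗ[k] B)
    (hT : ∀ a b : A, T a * T b = T (a * T b + T a * b + lam • (a * b)))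
    (hTh : ∀ x y : B, Th x * Th y = Th (x * Th y + Th x * y + lam • (x * y)))
    (p : B →ₗ[k] A) (hpmul : ∀ x y : B, p (x * y) = p x * p y)
    (hpsurj : Function.Surjective p)
    (hpT : ∀ x : B, p (Th x) = T (p x))
    (hMzero : ∀ m m' : B, p m = 0 → p m' = 0 → m * m' = 0)
    (hThM : ∀ m : B, p m = 0 → p (Th m) = 0)
    (s₁ s₂ : A →ₗ[k] B) (hs₁ : ∀ a : A, p (s₁ a) = a) (hs₂ : ∀ a : A, p (s₂ a) = a)
    (γ : A → B) (hγ : ∀ a : A, γ a = s₁ a - s₂ a)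
    (ψ₁ ψ₂ : A → A → B)
    (hψ₁ : ∀ a b : A, ψ₁ a b = s₁ a * s₁ b - s₁ (a * b))
    (hψ₂ : ∀ a b : A, ψ₂ a b = s₂ a * s₂ b - s₂ (a * b))
    (χ₁ χ₂ : A → B)
    (hχ₁ : ∀ a : A, χ₁ a = Th (s₁ a) - s₁ (T a))
    (hχ₂ : ∀ a : A, χ₂ a = Th (s₂ a) - s₂ (T a)) :
    (∀ (a : A) (m : B), p m = 0 → s₁ a * m = s₂ a * m ∧ m * s₁ a = m * s₂ a) ∧
    (∀ a b : A, ψ₁ a b = ψ₂ a b + s₂ a * γ b + γ a * s₂ b - γ (a * b)) ∧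
    (∀ a : A, χ₁ a = χ₂ a + Th (γ a) - γ (T a)) := by
  have hγp : ∀ a : A, p (γ a) = 0 := fun a => by
    rw [hγ, map_sub, hs₁, hs₂, sub_self]
  have hs : ∀ a : A, s₁ a = s₂ a + γ a := fun a => by
    rw [hγ, add_sub_cancel]
  refine ⟨fun a m hm => ⟨?_, ?_⟩, fun a b => ?_, fun a => ?_⟩
  · rw [hs, add_mul, hMzero _ _ (hγp a) hm, add_zero]
  · rw [hs, mul_add, hMzero _ _ hm (hγp a), add_zero]
  · rw [hψ₁, hψ₂, hs a, hs b, hs (a * b), add_mul, mul_add, mul_add,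
      hMzero _ _ (hγp a) (hγp b)]
    abel
  · rw [hχ₁, hχ₂, hs a, hs (T a), map_add]
    abel
end

section
/- Let (A,·,T) be a Rota-Baxter algebra of weight λ over a field k of characteristic 0 and (M,T_M) a Rota-Baxter bimodule over it. Given a k-bilinear map ψ : A × A → M and a k-linear map χ : A → M, define on A ⊕ M the product (a,m)·_ψ(b,n) := (a·b, an + mb + ψ(a,b)) and the k-linear map T_χ(a,m) := (T(a), χ(a) + T_M(m)). Then (A ⊕ M, ·_ψ, T_χ) is a Rota-Baxter algebra of weight λ (i.e. ·_ψ is associative and T_χ is a Rota-Baxter operator of weight λ for it) if and only if (ψ, χ) is a 2-cocycle of (A,·,T) with coefficients in (M,T_M), i.e.: for all a, b, c ∈ A, aψ(b,c) − ψ(ab,c) + ψ(a,bc) − ψ(a,b)c = 0, and T(a)χ(b) + χ(a)T(b) + ψ(T(a),T(b)) = T_M(χ(a)b) + T_M(ψ(T(a),b)) + χ(T(a)b) + T_M(aχ(b)) + T_M(ψ(a,T(b))) + χ(aT(b)) + λT_M(ψ(a,b)) + λχ(ab). -/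
/-- `(A ⊕ M, ·_ψ, T_χ)` is a Rota-Baxter algebra of weight `lam` if and only if `(ψ, χ)`
is a 2-cocycle of the Rota-Baxter algebra `(A, ·, T)` with coefficients in the
Rota-Baxter bimodule `(M, T_M)`. -/
theorem extension_isRotaBaxter_iff_twoCocycle {k A M : Type*} [Field k] [CharZero k]
    [NonUnitalRing A] [Module k A] [SMulCommClass k A A] [IsScalarTower k A A]
    [AddCommGroup M] [Module k M]
    (lam : k) (T : A →ₗ[k] A)
    (hT : ∀ a b : A, T a * T b = T (a * T b + T a * b + lam • (a * b)))
    (l r : A →ₗ[k] M →ₗ[k] M)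
    (hl : ∀ (a b : A) (m : M), l (a * b) m = l a (l b m))
    (hr : ∀ (a b : A) (m : M), r (a * b) m = r b (r a m))
    (hlr : ∀ (a b : A) (m : M), r b (l a m) = l a (r b m))
    (TM : M →ₗ[k] M)
    (hTM1 : ∀ (a : A) (m : M), l (T a) (TM m) = TM (l a (TM m) + l (T a) m + lam • l a m))
    (hTM2 : ∀ (a : A) (m : M), r (T a) (TM m) = TM (r (T a) m + r a (TM m) + lam • r a m))
    (ψ : A →ₗ[k] A →ₗ[k] M) (χ : A →ₗ[k] M)
    (mulψ : A × M → A × M → A × M)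
    (hmulψ : ∀ p q : A × M, mulψ p q = (p.1 * q.1, l p.1 q.2 + r q.1 p.2 + ψ p.1 q.1))
    (Tχ : A × M → A × M)
    (hTχ : ∀ p : A × M, Tχ p = (T p.1, χ p.1 + TM p.2)) :
    ((∀ p q u : A × M, mulψ (mulψ p q) u = mulψ p (mulψ q u)) ∧
     (∀ p q : A × M,
        mulψ (Tχ p) (Tχ q) = Tχ (mulψ p (Tχ q) + mulψ (Tχ p) q + lam • mulψ p q))) ↔
    ((∀ a b c : A, l a (ψ b c) - ψ (a * b) c + ψ a (b * c) - r c (ψ a b) = 0) ∧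
     (∀ a b : A,
        l (T a) (χ b) + r (T b) (χ a) + ψ (T a) (T b)
          = TM (r b (χ a)) + TM (ψ (T a) b) + χ (T a * b)
            + TM (l a (χ b)) + TM (ψ a (T b)) + χ (a * T b)
            + lam • TM (ψ a b) + lam • χ (a * b))) := by
  simp only [hmulψ, hTχ]
  refine and_congr ⟨fun h a b c => ?_, fun h p q u => ?_⟩ ⟨fun h a b => ?_, fun h p q => ?_⟩
  · have key := congrArg Prod.snd (h (a, 0) (b, 0) (c, 0))
    simp only [map_zero, zero_add, add_zero] at key
    rw [sub_add_eq_add_sub, sub_sub, sub_eq_zero, ← key, add_comm]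
  · refine Prod.ext (mul_assoc _ _ _) ?_
    have hc := h p.1 q.1 u.1
    simp only [map_add, hl, hr, hlr]
    rw [← sub_eq_zero, ← neg_eq_zero, ← hc]
    abel
  · have key := congrArg Prod.snd (h (a, 0) (b, 0))
    simp only [map_zero, add_zero, zero_add, Prod.fst_add, Prod.snd_add, Prod.smul_fst,
      Prod.smul_snd, map_add, map_smul] at key
    rw [key]
    abel
  · refine Prod.ext (hT _ _) ?_
    have hc := h p.1 q.1
    have hleft := hTM1 p.1 q.2
    have hright := hTM2 q.1 p.2
    simp only [map_add, map_smul] at hleft hright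
    simp only [Prod.fst_add, Prod.snd_add, Prod.smul_fst, Prod.smul_snd, map_add, map_smul,
      smul_add, hleft, hright]
    rw [← sub_eq_zero] at hc ⊢
    rw [← hc]
    abel
end

section
/- Let (A,·,T) be a Rota-Baxter algebra of weight λ over a field k of characteristic 0, (M,T_M) a Rota-Baxter bimodule over it, and (ψ₁, χ₁), (ψ₂, χ₂) two 2-cocycles of (A,·,T) with coefficients in (M,T_M). Suppose they are cohomologous: there is a k-linear map γ : A → M with ψ₁(a,b) = ψ₂(a,b) + aγ(b) + γ(a)b − γ(ab) and χ₁(a) = χ₂(a) + T_M(γ(a)) − γ(T(a)) for all a, b ∈ A. Then the map ζ : A ⊕ M → A ⊕ M, ζ(a,m) := (a, m + γ(a)), is an isomorphism of Rota-Baxter algebras from (A ⊕ M, ·_{ψ₁}, T_{χ₁}) to (A ⊕ M, ·_{ψ₂}, T_{χ₂}): ζ is a k-linear bijection, ζ((a,m)·_{ψ₁}(b,n)) = ζ(a,m)·_{ψ₂}ζ(b,n), and ζ(T_{χ₁}(a,m)) = T_{χ₂}(ζ(a,m)) for all a, b ∈ A, m, n ∈ M; moreover ζ fixes M and covers the identity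 of A, so the two abelian extensions are isomorphic. -/
/-- Two cohomologous 2-cocycles `(ψ₁, χ₁)` and `(ψ₂, χ₂)` of a Rota-Baxter algebra
`(A, ·, T)` with coefficients in a Rota-Baxter bimodule `(M, T_M)` give rise to
isomorphic abelian extensions, via `ζ(a, m) := (a, m + γ(a))`. -/
theorem cohomologousCocycles_isomorphicExtensions {k A M : Type*} [Field k] [CharZero k]
    [NonUnitalRing A] [Module k A] [SMulCommClass k A A] [IsScalarTower k A A]
    [AddCommGroup M] [Module k M]
    (lam : k) (T : A →ₗ[k] A)
    (hT : ∀ a b : A, T a * T b = T (a * T b + T a * b + lam • (a * b)))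
    (l r : A →ₗ[k] M →ₗ[k] M)
    (hl : ∀ (a b : A) (m : M), l (a * b) m = l a (l b m))
    (hr : ∀ (a b : A) (m : M), r (a * b) m = r b (r a m))
    (hlr : ∀ (a b : A) (m : M), r b (l a m) = l a (r b m))
    (TM : M →ₗ[k] M)
    (hTM1 : ∀ (a : A) (m : M), l (T a) (TM m) = TM (l a (TM m) + l (T a) m + lam • l a m))
    (hTM2 : ∀ (a : A) (m : M), r (T a) (TM m) = TM (r (T a) m + r a (TM m) + lam • r a m))
    (ψ₁ ψ₂ : A →ₗ[k] A →ₗ[k] M) (χ₁ χ₂ : A →ₗ[k] M)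
    (hcoc₁₁ : ∀ a b c : A, l a (ψ₁ b c) - ψ₁ (a * b) c + ψ₁ a (b * c) - r c (ψ₁ a b) = 0)
    (hcoc₁₂ : ∀ a b : A,
      l (T a) (χ₁ b) + r (T b) (χ₁ a) + ψ₁ (T a) (T b)
        = TM (r b (χ₁ a)) + TM (ψ₁ (T a) b) + χ₁ (T a * b)
          + TM (l a (χ₁ b)) + TM (ψ₁ a (T b)) + χ₁ (a * T b)
          + lam • TM (ψ₁ a b) + lam • χ₁ (a * b))
    (hcoc₂₁ : ∀ a b c : A, l a (ψ₂ b c) - ψ₂ (a * b) c + ψ₂ a (b * c) - r c (ψ₂ a b) = 0)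
    (hcoc₂₂ : ∀ a b : A,
      l (T a) (χ₂ b) + r (T b) (χ₂ a) + ψ₂ (T a) (T b)
        = TM (r b (χ₂ a)) + TM (ψ₂ (T a) b) + χ₂ (T a * b)
          + TM (l a (χ₂ b)) + TM (ψ₂ a (T b)) + χ₂ (a * T b)
          + lam • TM (ψ₂ a b) + lam • χ₂ (a * b))
    (γ : A →ₗ[k] M)
    (hγ1 : ∀ a b : A, ψ₁ a b = ψ₂ a b + l a (γ b) + r b (γ a) - γ (a * b))
    (hγ2 : ∀ a : A, χ₁ a = χ₂ a + TM (γ a) - γ (T a))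
    (mul₁ mul₂ : A × M → A × M → A × M)
    (hmul₁ : ∀ p q : A × M, mul₁ p q = (p.1 * q.1, l p.1 q.2 + r q.1 p.2 + ψ₁ p.1 q.1))
    (hmul₂ : ∀ p q : A × M, mul₂ p q = (p.1 * q.1, l p.1 q.2 + r q.1 p.2 + ψ₂ p.1 q.1))
    (Tχ₁ Tχ₂ : A × M → A × M)
    (hTχ₁ : ∀ p : A × M, Tχ₁ p = (T p.1, χ₁ p.1 + TM p.2))
    (hTχ₂ : ∀ p : A × M, Tχ₂ p = (T p.1, χ₂ p.1 + TM p.2))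
    (ζ : A × M → A × M)
    (hζ : ∀ p : A × M, ζ p = (p.1, p.2 + γ p.1)) :
    Function.Bijective ζ ∧
    (∀ (c : k) (p q : A × M), ζ (c • p + q) = c • ζ p + ζ q) ∧
    (∀ p q : A × M, ζ (mul₁ p q) = mul₂ (ζ p) (ζ q)) ∧
    (∀ p : A × M, ζ (Tχ₁ p) = Tχ₂ (ζ p)) ∧
    (∀ m : M, ζ (0, m) = (0, m)) ∧
    (∀ p : A × M, (ζ p).1 = p.1) := by
  refine ⟨⟨fun p q h => ?_, fun p => ⟨(p.1, p.2 - γ p.1), by simp [hζ]⟩⟩, fun c p q => ?_,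
    fun p q => ?_, fun p => ?_, fun m => by simp [hζ], fun p => by simp [hζ]⟩
  · simp only [hζ, Prod.mk.injEq] at h
    obtain ⟨h₁, h₂⟩ := h
    rw [h₁] at h₂
    exact Prod.ext h₁ (add_right_cancel h₂)
  · simp only [hζ]
    ext
    · rfl
    · simp only [Prod.fst_add, Prod.snd_add, Prod.smul_fst, Prod.smul_snd, map_add, map_smul,
        smul_add]
      abel
  · simp only [hζ, hmul₁, hmul₂, hγ1, map_add]
    ext
    · rfl
    · dsimp only
      abel
  · simp only [hζ, hTχ₁, hTχ₂, hγ2, map_add]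
    ext
    · rfl
    · dsimp only
      abel
end

section
/- Let (A,·,T) be a Rota-Baxter algebra of weight λ over a field k of characteristic 0, (M,T_M) a Rota-Baxter bimodule over it, and (ψ₁, χ₁), (ψ₂, χ₂) two 2-cocycles of (A,·,T) with coefficients in (M,T_M). Suppose ζ : A ⊕ M → A ⊕ M is a k-linear bijection with ζ((a,m)·_{ψ₁}(b,n)) = ζ(a,m)·_{ψ₂}ζ(b,n) and ζ∘T_{χ₁} = T_{χ₂}∘ζ, which moreover fixes M (ζ(0,m) = (0,m)) and covers the identity of A (the first component of ζ(a,m) is a). Then the two cocycles are cohomologous: there exists a k-linear map γ : A → M such that ψ₁(a,b) = ψ₂(a,b) + aγ(b) + γ(a)b − γ(ab) and χ₁(a) = χ₂(a) + T_M(γ(a)) − γ(T(a)) for all a, b ∈ A. Hence isomorphic abelian extensions give rise to the same cohomology class. -/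
/-- Isomorphic abelian extensions of a Rota-Baxter algebra `(A, ·, T)` by a Rota-Baxter
bimodule `(M, T_M)` give rise to cohomologous 2-cocycles. -/
theorem isomorphicExtensions_cohomologousCocycles {k A M : Type*} [Field k] [CharZero k]
    [NonUnitalRing A] [Module k A] [SMulCommClass k A A] [IsScalarTower k A A]
    [AddCommGroup M] [Module k M]
    (lam : k) (T : A →ₗ[k] A)
    (hT : ∀ a b : A, T a * T b = T (a * T b + T a * b + lam • (a * b)))
    (l r : A →ₗ[k] M →ₗ[k] M)
    (hl : ∀ (a b : A) (m : M), l (a * b) m = l a (l b m))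
    (hr : ∀ (a b : A) (m : M), r (a * b) m = r b (r a m))
    (hlr : ∀ (a b : A) (m : M), r b (l a m) = l a (r b m))
    (TM : M →ₗ[k] M)
    (hTM1 : ∀ (a : A) (m : M), l (T a) (TM m) = TM (l a (TM m) + l (T a) m + lam • l a m))
    (hTM2 : ∀ (a : A) (m : M), r (T a) (TM m) = TM (r (T a) m + r a (TM m) + lam • r a m))
    (ψ₁ ψ₂ : A →ₗ[k] A →ₗ[k] M) (χ₁ χ₂ : A →ₗ[k] M)
    (hcoc₁₁ : ∀ a b c : A, l a (ψ₁ b c) - ψ₁ (a * b) c + ψ₁ a (b * c) - r c (ψ₁ a b) = 0)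
    (hcoc₁₂ : ∀ a b : A,
      l (T a) (χ₁ b) + r (T b) (χ₁ a) + ψ₁ (T a) (T b)
        = TM (r b (χ₁ a)) + TM (ψ₁ (T a) b) + χ₁ (T a * b)
          + TM (l a (χ₁ b)) + TM (ψ₁ a (T b)) + χ₁ (a * T b)
          + lam • TM (ψ₁ a b) + lam • χ₁ (a * b))
    (hcoc₂₁ : ∀ a b c : A, l a (ψ₂ b c) - ψ₂ (a * b) c + ψ₂ a (b * c) - r c (ψ₂ a b) = 0)
    (hcoc₂₂ : ∀ a b : A,
      l (T a) (χ₂ b) + r (T b) (χ₂ a) + ψ₂ (T a) (T b)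
        = TM (r b (χ₂ a)) + TM (ψ₂ (T a) b) + χ₂ (T a * b)
          + TM (l a (χ₂ b)) + TM (ψ₂ a (T b)) + χ₂ (a * T b)
          + lam • TM (ψ₂ a b) + lam • χ₂ (a * b))
    (mul₁ mul₂ : A × M → A × M → A × M)
    (hmul₁ : ∀ p q : A × M, mul₁ p q = (p.1 * q.1, l p.1 q.2 + r q.1 p.2 + ψ₁ p.1 q.1))
    (hmul₂ : ∀ p q : A × M, mul₂ p q = (p.1 * q.1, l p.1 q.2 + r q.1 p.2 + ψ₂ p.1 q.1))
    (Tχ₁ Tχ₂ : A × M → A × M)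
    (hTχ₁ : ∀ p : A × M, Tχ₁ p = (T p.1, χ₁ p.1 + TM p.2))
    (hTχ₂ : ∀ p : A × M, Tχ₂ p = (T p.1, χ₂ p.1 + TM p.2))
    (ζ : A × M → A × M)
    (hζbij : Function.Bijective ζ)
    (hζlin : ∀ (c : k) (p q : A × M), ζ (c • p + q) = c • ζ p + ζ q)
    (hζmul : ∀ p q : A × M, ζ (mul₁ p q) = mul₂ (ζ p) (ζ q))
    (hζT : ∀ p : A × M, ζ (Tχ₁ p) = Tχ₂ (ζ p))
    (hζM : ∀ m : M, ζ (0, m) = (0, m))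
    (hζfst : ∀ p : A × M, (ζ p).1 = p.1) :
    ∃ γ : A →ₗ[k] M,
      (∀ a b : A, ψ₁ a b = ψ₂ a b + l a (γ b) + r b (γ a) - γ (a * b)) ∧
      (∀ a : A, χ₁ a = χ₂ a + TM (γ a) - γ (T a)) := by
  have hadd (p q : A × M) : ζ (p + q) = ζ p + ζ q := by simpa using hζlin 1 p q
  have hsmul (c : k) (p : A × M) : ζ (c • p) = c • ζ p := by
    have h0 : ζ 0 = 0 := hζM 0
    simpa [h0] using hζlin c p 0
  let ζl : A × M →ₗ[k] A × M := { toFun := ζ, map_add' := hadd, map_smul' := hsmul }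
  let γ : A →ₗ[k] M := LinearMap.snd k A M ∘ₗ ζl ∘ₗ LinearMap.inl k A M
  have hζ (a : A) (m : M) : ζ (a, m) = (a, γ a + m) := by
    refine Prod.ext (hζfst _) ?_
    have h := hadd (a, 0) (0, m)
    rw [Prod.mk_add_mk, add_zero, zero_add, hζM] at h
    rw [h]
    rfl
  refine ⟨γ, fun a b => ?_, fun a => ?_⟩
  · have h := congrArg Prod.snd (hζmul (a, 0) (b, 0))
    simp only [hmul₁, hmul₂, hζ, map_zero, add_zero, zero_add] at h
    rw [eq_sub_iff_add_eq, add_comm, h]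
    abel
  · have h := congrArg Prod.snd (hζT (a, 0))
    simp only [hTχ₁, hTχ₂, hζ, map_zero, add_zero] at h
    rw [eq_sub_iff_add_eq, add_comm, h]
end

section
/- Let (A,·,T) be a Rota-Baxter algebra of weight λ over a field k of characteristic 0 and (M,T_M) a Rota-Baxter bimodule over it. Then Φ• : C•_Alg(A,M) → C•_RBO(A,M) is a chain map: for every n ≥ 0 and every k-multilinear map f : A^n → M, Φ^{n+1}(δⁿ(f)) = ∂ⁿ(Φⁿ(f)). -/
/-- The Hochschild coboundary `δⁿ` of the algebra `A` with coefficients in a bimodule `M`,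
on `n`-cochains viewed as functions `(Fin n → A) → M` (0-indexed version of
`δⁿ(f)(a₁,…,a_{n+1}) = (−1)^{n+1} a₁ f(a₂,…,a_{n+1})
  + Σ_{i=1}^{n} (−1)^{n−i+1} f(a₁,…, a_i a_{i+1},…,a_{n+1}) + f(a₁,…,a_n) a_{n+1}`). -/
def hochschildCoboundary {A M : Type*} [NonUnitalRing A] [AddCommGroup M]
    (lsmul : A → M → M) (rsmul : M → A → M)
    (n : ℕ) (f : (Fin n → A) → M) : (Fin (n + 1) → A) → M := fun a =>
  ((-1 : ℤ) ^ (n + 1)) • lsmul (a 0) (f fun i => a i.succ)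
    + (∑ i : Fin n, ((-1 : ℤ) ^ (n - (i : ℕ))) • f (fun j =>
        if (j : ℕ) < (i : ℕ) then a j.castSucc
        else if (j : ℕ) = (i : ℕ) then a j.castSucc * a j.succ
        else a j.succ))
    + rsmul (f fun i => a i.castSucc) (a (Fin.last n))

/-- The coboundary `∂ⁿ` of the cochain complex of a Rota-Baxter operator `T` with
coefficients in a Rota-Baxter bimodule `(M, TM)` (0-indexed version). -/
def rboCoboundary {k A M : Type*} [Field k] [NonUnitalRing A] [Module k A]
    [AddCommGroup M] [Module k M]
    (lsmul : A → M → M) (rsmul : M → A → M) (T : A → A) (TM : M → M) (lam : k)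
    (n : ℕ) (f : (Fin n → A) → M) : (Fin (n + 1) → A) → M := fun a =>
  ((-1 : ℤ) ^ (n + 1)) •
      (lsmul (T (a 0)) (f fun i => a i.succ) - TM (lsmul (a 0) (f fun i => a i.succ)))
    + (∑ i : Fin n, ((-1 : ℤ) ^ (n - (i : ℕ))) •
        (f (fun j =>
            if (j : ℕ) < (i : ℕ) then a j.castSucc
            else if (j : ℕ) = (i : ℕ) then a j.castSucc * T (a j.succ)
            else a j.succ)
          + f (fun j =>
            if (j : ℕ) < (i : ℕ) then a j.castSucc
            else if (j : ℕ) = (i : ℕ) then T (a j.castSucc) * a j.succ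
            else a j.succ)
          + lam • f (fun j =>
            if (j : ℕ) < (i : ℕ) then a j.castSucc
            else if (j : ℕ) = (i : ℕ) then a j.castSucc * a j.succ
            else a j.succ)))
    + (rsmul (f fun i => a i.castSucc) (T (a (Fin.last n)))
        - TM (rsmul (f fun i => a i.castSucc) (a (Fin.last n))))

/-- The chain map `Φⁿ` from the Hochschild cochain complex to the cochain complex of the
Rota-Baxter operator:
`Φⁿ(f)(a₁,…,a_n) = f(T a₁,…,T a_n) − Σ_{k=0}^{n−1} λ^{n−k−1} Σ_{|S| = k} T_M(f(c))`,
where `c_j = T(a_j)` for `j ∈ S` and `c_j = a_j` otherwise. -/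
def PhiMap {k A M : Type*} [Field k] [NonUnitalRing A] [Module k A]
    [AddCommGroup M] [Module k M]
    (T : A → A) (TM : M → M) (lam : k)
    (n : ℕ) (f : (Fin n → A) → M) : (Fin n → A) → M := fun a =>
  f (fun j => T (a j))
    - ∑ c ∈ Finset.range n, (lam ^ (n - c - 1)) •
        ∑ S ∈ Finset.powersetCard c (Finset.univ : Finset (Fin n)),
          TM (f fun j => if j ∈ S then T (a j) else a j)

/-- Replace the adjacent entries `a i, a (i + 1)` of a tuple by `op (a i) (a (i + 1))`. -/
def contractAt {A : Type*} (op : A → A → A) {n : ℕ} (i : Fin n) (a : Fin (n + 1) → A) :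
    Fin n → A := fun j =>
  if (j : ℕ) < (i : ℕ) then a j.castSucc
  else if (j : ℕ) = (i : ℕ) then op (a j.castSucc) (a j.succ)
  else a j.succ

theorem contractAt_zero {A : Type*} (op : A → A → A) {n : ℕ} (a : Fin (n + 2) → A) :
    contractAt op 0 a = Fin.cons (op (a 0) (a 1)) (Fin.tail (Fin.tail a)) := by
  ext j
  cases j using Fin.cases <;> simp [contractAt, Fin.tail]

theorem contractAt_succ {A : Type*} (op : A → A → A) {n : ℕ} (i : Fin n) (a : Fin (n + 2) → A) :
    contractAt op i.succ a = Fin.cons (a 0) (contractAt op i (Fin.tail a)) := by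
  ext j
  cases j using Fin.cases <;> simp [contractAt, Fin.tail]

section

variable {k A M : Type*} [Field k] [AddCommGroup M] [Module k M]

/-- The weighted sum `Σ_{S ⊊ Fin n} λ^{n-|S|-1} g(c_S)`, as a linear functional of `g`, where
`(c_S)_j = T (a j)` for `j ∈ S` and `(c_S)_j = a j` otherwise, by recursion on the first
coordinate. -/
def properSubsetSum (T : A → A) (lam : k) :
    (n : ℕ) → (Fin n → A) → ((Fin n → A) → M) →ₗ[k] M
  | 0, _ => 0
  | n + 1, a =>
    properSubsetSum T lam n (Fin.tail a) ∘ₗ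
        LinearMap.funLeft k M (fun b => Fin.cons (T (a 0)) b)
      + lam • properSubsetSum T lam n (Fin.tail a) ∘ₗ
          LinearMap.funLeft k M (fun b => Fin.cons (a 0) b)
      + LinearMap.proj (Fin.cons (a 0) fun j => T (Fin.tail a j))

theorem properSubsetSum_zero (T : A → A) (lam : k) (a : Fin 0 → A) (g : (Fin 0 → A) → M) :
    properSubsetSum T lam 0 a g = 0 := rfl

theorem properSubsetSum_succ (T : A → A) (lam : k) (n : ℕ) (a : Fin (n + 1) → A)
    (g : (Fin (n + 1) → A) → M) :
    properSubsetSum T lam (n + 1) a g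
      = properSubsetSum T lam n (Fin.tail a) (fun b => g (Fin.cons (T (a 0)) b))
        + lam • properSubsetSum T lam n (Fin.tail a) (fun b => g (Fin.cons (a 0) b))
        + g (Fin.cons (a 0) fun j => T (Fin.tail a j)) := rfl

theorem properSubsetSum_comp (T : A → A) (lam : k) (L : M →ₗ[k] M) (n : ℕ) (a : Fin n → A)
    (g : (Fin n → A) → M) :
    properSubsetSum T lam n a (fun b => L (g b)) = L (properSubsetSum T lam n a g) := by
  induction n with
  | zero => simp [properSubsetSum_zero]
  | succ n ih => simp only [properSubsetSum_succ, ih, map_add, map_smul]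

/-- The coefficient of the subset `S` in `properSubsetSum`. -/
def properSubsetWeight (lam : k) (n : ℕ) (S : Finset (Fin n)) : k :=
  if S = Finset.univ then 0 else lam ^ (n - S.card - 1)

theorem sum_finset_fin_succ {n : ℕ} (F : Finset (Fin (n + 1)) → M) :
    ∑ S, F S = ∑ S : Finset (Fin n), F (S.map (Fin.succEmb n))
      + ∑ S : Finset (Fin n), F (insert 0 (S.map (Fin.succEmb n))) := by
  have h : (Finset.univ : Finset (Fin (n + 1)))
      = insert 0 (Finset.univ.map (Fin.succEmb n)) := by
    ext j; cases j using Fin.cases <;> simp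
  have h' : ((Finset.univ : Finset (Fin n)).map (Fin.succEmb n)).powerset
      = Finset.univ.map (Finset.mapEmbedding (Fin.succEmb n)).toEmbedding := by
    ext S
    simp only [Finset.mem_powerset, Finset.subset_map_iff, Finset.mem_map]
    simp [eq_comm]
  rw [← Finset.powerset_univ, h, Finset.sum_powerset_insert (by simp), h', Finset.sum_map,
    Finset.sum_map]
  rfl

theorem properSubsetWeight_map_succ (lam : k) (n : ℕ) (S : Finset (Fin n)) :
    properSubsetWeight lam (n + 1) (S.map (Fin.succEmb n))
      = lam * properSubsetWeight lam n S + if S = Finset.univ then 1 else 0 := by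
  have h : S.map (Fin.succEmb n) ≠ Finset.univ := fun h => by
    have := h ▸ Finset.mem_univ (0 : Fin (n + 1))
    simp at this
  by_cases hS : S = Finset.univ
  · subst hS
    rw [properSubsetWeight, if_neg h]
    simp [properSubsetWeight]
  · have hc : S.card < n := by
      simpa using Finset.card_lt_univ_of_notMem
        (Classical.not_forall.1 fun H => hS (Finset.eq_univ_iff_forall.2 H)).choose_spec
    rw [properSubsetWeight, properSubsetWeight, if_neg h, if_neg hS, if_neg hS, Finset.card_map,
      add_zero, ← pow_succ']
    congr 1
    omega

theorem properSubsetWeight_insert_zero (lam : k) (n : ℕ) (S : Finset (Fin n)) :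
    properSubsetWeight lam (n + 1) (insert 0 (S.map (Fin.succEmb n)))
      = properSubsetWeight lam n S := by
  have h : insert 0 (S.map (Fin.succEmb n)) = Finset.univ ↔ S = Finset.univ := by
    simp [Finset.eq_univ_iff_forall, Fin.forall_fin_succ]
  rw [properSubsetWeight, properSubsetWeight, Finset.card_insert_of_notMem (by simp),
    Finset.card_map]
  simp only [h, Nat.add_sub_add_right]

theorem properSubsetSum_eq_sum (T : A → A) (lam : k) (n : ℕ) (a : Fin n → A)
    (g : (Fin n → A) → M) :
    properSubsetSum T lam n a g
      = ∑ S, properSubsetWeight lam n S • g (fun j => if j ∈ S then T (a j) else a j) := by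
  induction n with
  | zero =>
    simp [properSubsetSum_zero, properSubsetWeight, Subsingleton.elim _ (∅ : Finset (Fin 0))]
  | succ n ih =>
    have h1 (S : Finset (Fin n)) :
        (fun j => if j ∈ S.map (Fin.succEmb n) then T (a j) else a j)
          = Fin.cons (a 0) fun j => if j ∈ S then T (Fin.tail a j) else Fin.tail a j := by
      ext j; cases j using Fin.cases <;> simp [Fin.tail]
    have h2 (S : Finset (Fin n)) :
        (fun j => if j ∈ insert 0 (S.map (Fin.succEmb n)) then T (a j) else a j)
          = Fin.cons (T (a 0)) fun j => if j ∈ S then T (Fin.tail a j) else Fin.tail a j := by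
      ext j; cases j using Fin.cases <;> simp [Fin.tail]
    rw [sum_finset_fin_succ, properSubsetSum_succ, ih, ih]
    simp only [properSubsetWeight_map_succ, properSubsetWeight_insert_zero, h1, h2, add_smul,
      Finset.sum_add_distrib, mul_smul, ← Finset.smul_sum, ite_smul, one_smul, zero_smul,
      Finset.sum_ite_eq', Finset.mem_univ, if_true]
    abel

theorem PhiMap_apply [NonUnitalRing A] [Module k A] (T : A → A) (TM : M →ₗ[k] M) (lam : k)
    (n : ℕ) (f : (Fin n → A) → M) (a : Fin n → A) :
    PhiMap T TM lam n f a = f (fun j => T (a j)) - TM (properSubsetSum T lam n a f) := by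
  rw [PhiMap, properSubsetSum_eq_sum, ← Finset.powerset_univ, Finset.sum_powerset,
    Finset.card_univ, Fintype.card_fin, Finset.sum_range_succ,
    Finset.sum_eq_zero (s := Finset.powersetCard n Finset.univ), add_zero, map_sum]
  · congr 1
    refine Finset.sum_congr rfl fun c hc => ?_
    rw [map_sum, Finset.smul_sum]
    refine Finset.sum_congr rfl fun S hS => ?_
    have hS' := (Finset.mem_powersetCard.1 hS).2
    have : S ≠ Finset.univ := by
      rintro rfl
      simp at hS' hc
      omega
    rw [properSubsetWeight, if_neg this, hS', map_smul]
  · intro S hS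
    have hS' := (Finset.mem_powersetCard.1 hS).2
    have : S = Finset.univ := (Finset.card_eq_iff_eq_univ S).1 (by simpa using hS')
    rw [properSubsetWeight, if_pos this, zero_smul]

theorem apply_contractAt_add [NonUnitalRing A] [Module k A] (lam : k)
    (op₁ op₂ op₃ : A → A → A) {n : ℕ} (i : Fin n)
    (f : MultilinearMap k (fun _ : Fin n => A) M) (a : Fin (n + 1) → A) :
    f (contractAt (fun x y => op₁ x y + op₂ x y + lam • op₃ x y) i a)
      = f (contractAt op₁ i a) + f (contractAt op₂ i a) + lam • f (contractAt op₃ i a) := by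
  induction n with
  | zero => exact i.elim0
  | succ n ih =>
    cases i using Fin.cases with
    | zero => simp only [contractAt_zero, ← f.curryLeft_apply, map_add, map_smul,
        add_apply, smul_apply]
    | succ i =>
      simp only [contractAt_succ]
      exact ih i (f.curryLeft (a 0)) (Fin.tail a)

end

section RotaBaxter

variable {k A M : Type*} [Field k] [NonUnitalRing A] [Module k A] [AddCommGroup M] [Module k M]
  {lam : k} {T : A →ₗ[k] A}

theorem apply_contractAt_mul
    (hT : ∀ a b : A, T a * T b = T (a * T b + T a * b + lam • (a * b)))
    {n : ℕ} (i : Fin n) (f : MultilinearMap k (fun _ : Fin n => A) M) (a : Fin (n + 1) → A) :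
    f (contractAt (fun x y => x * y) i fun j => T (a j))
      = f (fun j => T (contractAt (fun x y => x * T y) i a j))
        + f (fun j => T (contractAt (fun x y => T x * y) i a j))
        + lam • f (fun j => T (contractAt (fun x y => x * y) i a j)) := by
  have h (op : A → A → A) : f (fun j => T (contractAt op i a j))
      = f.compLinearMap (fun _ => T) (contractAt op i a) := rfl
  rw [h, h, h, ← apply_contractAt_add, MultilinearMap.compLinearMap_apply]
  congr 1
  ext j
  simp only [contractAt, hT]
  split_ifs <;> rfl

theorem properSubsetSum_contractAt_mul
    (hT : ∀ a b : A, T a * T b = T (a * T b + T a * b + lam • (a * b)))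
    {n : ℕ} (i : Fin n) (f : MultilinearMap k (fun _ : Fin n => A) M) (a : Fin (n + 1) → A) :
    properSubsetSum T lam (n + 1) a (fun b => f (contractAt (fun x y => x * y) i b))
      = properSubsetSum T lam n (contractAt (fun x y => x * T y) i a) f
        + properSubsetSum T lam n (contractAt (fun x y => T x * y) i a) f
        + lam • properSubsetSum T lam n (contractAt (fun x y => x * y) i a) f := by
  induction n with
  | zero => exact i.elim0
  | succ n ih =>
    cases i using Fin.cases with
    | zero =>
      have hadd (b : Fin n → A) (u v w : A) :
          properSubsetSum T lam n b
              (fun c => f.curryLeft u c + f.curryLeft v c + lam • f.curryLeft w c)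
            = properSubsetSum T lam n b (fun c => f.curryLeft u c)
              + properSubsetSum T lam n b (fun c => f.curryLeft v c)
              + lam • properSubsetSum T lam n b (fun c => f.curryLeft w c) := by
        rw [← map_smul, ← map_add, ← map_add]; rfl
      have hc' (x : A) (b : Fin n → A) : f (Fin.cons x b) = f.curryLeft x b := rfl
      have h1 : Fin.tail a 0 = a 1 := rfl
      have h2 : (Fin.tail fun j => T (Fin.tail a j)) = fun j => T (Fin.tail (Fin.tail a) j) := rfl
      simp only [contractAt_zero, properSubsetSum_succ, Fin.cons_zero, Fin.cons_one, Fin.tail_cons,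
        hc', h1, h2, hT, map_add, map_smul, add_apply, smul_apply, hadd]
      module
    | succ i =>
      have hc (x : A) (op : A → A → A) :
          (fun b => f (Fin.cons x (contractAt op i b)))
            = fun b => f.curryLeft x (contractAt op i b) := rfl
      have hc' (x : A) : (fun b => f (Fin.cons x b)) = f.curryLeft x := rfl
      have h2 (b : Fin n → A) : f (Fin.cons (a 0) b) = f.curryLeft (a 0) b := rfl
      simp only [contractAt_succ, properSubsetSum_succ, Fin.cons_zero, Fin.tail_cons, hc, hc', ih,
        h2, apply_contractAt_mul hT]
      module

theorem properSubsetSum_left (l : A →ₗ[k] M →ₗ[k] M) (n : ℕ) (f : (Fin n → A) → M)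
    (a : Fin (n + 1) → A) :
    properSubsetSum T lam (n + 1) a (fun b => l (b 0) (f fun i => b i.succ))
      = l (T (a 0)) (properSubsetSum T lam n (fun i => a i.succ) f)
        + lam • l (a 0) (properSubsetSum T lam n (fun i => a i.succ) f)
        + l (a 0) (f fun i => T (a i.succ)) := by
  simp only [properSubsetSum_succ, Fin.cons_zero, Fin.cons_succ, properSubsetSum_comp]
  rfl

theorem properSubsetSum_right (r : A →ₗ[k] M →ₗ[k] M) (n : ℕ) (f : (Fin n → A) → M)
    (a : Fin (n + 1) → A) :
    properSubsetSum T lam (n + 1) a (fun b => r (b (Fin.last n)) (f fun i => b i.castSucc))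
      = r (T (a (Fin.last n))) (properSubsetSum T lam n (fun i => a i.castSucc) f)
        + lam • r (a (Fin.last n)) (properSubsetSum T lam n (fun i => a i.castSucc) f)
        + r (a (Fin.last n)) (f fun i => T (a i.castSucc)) := by
  induction n with
  | zero =>
    simp only [properSubsetSum_succ, properSubsetSum_zero, map_zero, smul_zero, zero_add]
    congr 2
    exact Subsingleton.elim _ _
  | succ n ih =>
    have h (x : A) (b : Fin (n + 1) → A) :
        (fun i : Fin (n + 1) => (Fin.cons x b : Fin (n + 2) → A) i.castSucc)
          = Fin.cons x fun i => b i.castSucc := by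
      ext j; cases j using Fin.cases <;> rfl
    have h' (x : A) (b : Fin (n + 1) → A) :
        (Fin.cons x b : Fin (n + 2) → A) (Fin.last (n + 1)) = b (Fin.last n) := rfl
    have ih' (x : A) := ih (fun b => f (Fin.cons x b)) (Fin.tail a)
    rw [properSubsetSum_succ]
    simp only [h, h', ih']
    simp only [properSubsetSum_succ, map_add, map_smul]
    have hlast : Fin.tail a (Fin.last n) = a (Fin.last (n + 1)) := rfl
    have htail : Fin.tail (fun i : Fin (n + 1) => a i.castSucc)
        = fun i => Fin.tail a i.castSucc := rfl
    have hcons : (fun i : Fin (n + 1) => T (a i.castSucc))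
        = Fin.cons (T (a 0)) fun i => T (Fin.tail a i.castSucc) := by
      ext j; cases j using Fin.cases <;> rfl
    simp only [hlast, htail, hcons, Fin.castSucc_zero]
    module

end RotaBaxter

/-- `Φ• : C•_Alg(A,M) → C•_RBO(A,M)` is a chain map: for every `n` and every
`k`-multilinear `f : Aⁿ → M`, `Φ^{n+1}(δⁿ f) = ∂ⁿ(Φⁿ f)`. -/
theorem Phi_chainMap {k A M : Type*} [Field k] [CharZero k]
    [NonUnitalRing A] [Module k A] [SMulCommClass k A A] [IsScalarTower k A A]
    [AddCommGroup M] [Module k M]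
    (lam : k) (T : A →ₗ[k] A)
    (hT : ∀ a b : A, T a * T b = T (a * T b + T a * b + lam • (a * b)))
    (l r : A →ₗ[k] M →ₗ[k] M)
    (hl : ∀ (a b : A) (m : M), l (a * b) m = l a (l b m))
    (hr : ∀ (a b : A) (m : M), r (a * b) m = r b (r a m))
    (hlr : ∀ (a b : A) (m : M), r b (l a m) = l a (r b m))
    (TM : M →ₗ[k] M)
    (hTM1 : ∀ (a : A) (m : M), l (T a) (TM m) = TM (l a (TM m) + l (T a) m + lam • l a m))
    (hTM2 : ∀ (a : A) (m : M), r (T a) (TM m) = TM (r (T a) m + r a (TM m) + lam • r a m)) :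
    ∀ (n : ℕ) (f : MultilinearMap k (fun _ : Fin n => A) M),
      PhiMap (⇑T) (⇑TM) lam (n + 1)
          (hochschildCoboundary (fun a m => l a m) (fun m a => r a m) n ⇑f)
        = rboCoboundary (fun a m => l a m) (fun m a => r a m) (⇑T) (⇑TM) lam n
            (PhiMap (⇑T) (⇑TM) lam n ⇑f) := by
  intro n f
  ext a
  have hδ : hochschildCoboundary (fun a m => l a m) (fun m a => r a m) n ⇑f
      = ((-1 : ℤ) ^ (n + 1)) • (fun b : Fin (n + 1) → A => l (b 0) (f fun i => b i.succ))
        + (∑ i : Fin n, ((-1 : ℤ) ^ (n - (i : ℕ))) •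
            fun b : Fin (n + 1) → A => f (contractAt (fun x y => x * y) i b))
        + fun b : Fin (n + 1) → A => r (b (Fin.last n)) (f fun i => b i.castSucc) := by
    ext b
    simp only [hochschildCoboundary, Pi.add_apply, Pi.smul_apply, Finset.sum_apply]
    rfl
  have hPhi (b : Fin n → A) := PhiMap_apply T TM lam n f b
  have hd : rboCoboundary (fun a m => l a m) (fun m a => r a m) (⇑T) (⇑TM) lam n
        (PhiMap (⇑T) (⇑TM) lam n ⇑f) a
      = ((-1 : ℤ) ^ (n + 1)) •
          (l (T (a 0)) (PhiMap T TM lam n f fun i => a i.succ)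
            - TM (l (a 0) (PhiMap T TM lam n f fun i => a i.succ)))
        + (∑ i : Fin n, ((-1 : ℤ) ^ (n - (i : ℕ))) •
            (PhiMap T TM lam n f (contractAt (fun x y => x * T y) i a)
              + PhiMap T TM lam n f (contractAt (fun x y => T x * y) i a)
              + lam • PhiMap T TM lam n f (contractAt (fun x y => x * y) i a)))
        + (r (T (a (Fin.last n))) (PhiMap T TM lam n f fun i => a i.castSucc)
            - TM (r (a (Fin.last n)) (PhiMap T TM lam n f fun i => a i.castSucc))) := rfl
  have hmid (i : Fin n) :
      PhiMap T TM lam n f (contractAt (fun x y => x * T y) i a)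
          + PhiMap T TM lam n f (contractAt (fun x y => T x * y) i a)
          + lam • PhiMap T TM lam n f (contractAt (fun x y => x * y) i a)
        = f (contractAt (fun x y => x * y) i fun j => T (a j))
          - TM (properSubsetSum T lam (n + 1) a
              fun b => f (contractAt (fun x y => x * y) i b)) := by
    rw [properSubsetSum_contractAt_mul hT, apply_contractAt_mul hT, hPhi, hPhi, hPhi, map_add,
      map_add, map_smul]
    module
  rw [hd, PhiMap_apply, hδ]
  simp only [hmid]
  simp only [hPhi, map_add, map_sum, map_zsmul, properSubsetSum_left,
    properSubsetSum_right, Pi.add_apply, Pi.smul_apply, Finset.sum_apply, map_sub, hTM1, hTM2,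
    smul_sub, Finset.sum_sub_distrib, map_smul]
  module
end
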